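/- Let σ₁,…,σ₆ ∈ {±1} be signs such that none of the triples (σ₁,σ₂,σ₄), (−σ₂,σ₃,σ₅), (−σ₃,−σ₄,σ₆) has all three entries equal. For k⁽¹⁾, k⁽²⁾, k⁽³⁾ ∈ ℤ_L^d and β⁽¹⁾, β⁽²⁾, β⁽³⁾ ∈ ℝ, the number of 6-tuples (k₁,…,k₆) ∈ (ℤ_L^d)⁶ with |k_j − k_j⁰| ≤ 1 for each j, satisfying σ₁k₁ + σ₂k₂ + σ₄k₄ = k⁽¹⁾, −σ₂k₂ + σ₃k₃ + σ₅k₅ = k⁽²⁾, −σ₃k₃ − σ₄k₄ + σ₆k₆ = k⁽³⁾, together with |σ₁|k₁|² + σ₂|k₂|² + σ₄|k₄|² − β⁽¹⁾| ≤ δ^{−1}L^{−2γ}, |−σ₂|k₂|² + σ₃|k₃|² + σ₅|k₅|² − β⁽²⁾| ≤ δ^{−1}L^{−2γ}, and |−σ₃|k₃|² − σ₄|k₄|² + σ₆|k₆|² − β⁽³⁾| ≤ δ^{−1}L^{−2γ}, is at most C·δ^{−3}·L^{3(d−γ)−1.01γ₀}. -/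

import Mathlib

open scoped RealInnerProductSpace BigOperators

noncomputable section

/-- The rescaled lattice `ℤ_L^d = (L⁻¹ℤ)^d` inside `ℝ^d`. -/
def ZLat (d : ℕ) (L : ℝ) : Set (EuclideanSpace ℝ (Fin d)) :=
  {x | ∀ i, ∃ m : ℤ, x i = (m : ℝ) / L}

/-- A finite set of integers with pairwise differences at most `D` has at most `D + 1` elements. -/
lemma card_int_le (S : Finset ℤ) (D : ℝ) (hD : 0 ≤ D)
    (h : ∀ a ∈ S, ∀ b ∈ S, |(a : ℝ) - b| ≤ D) : (S.card : ℝ) ≤ D + 1 := by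
  rcases S.eq_empty_or_nonempty with rfl | hne
  · simp; linarith
  have hsub : S ⊆ Finset.Icc (S.min' hne) (S.min' hne + ⌊D⌋) := by
    intro a ha
    have h1 := S.min'_le a ha
    have h2 := h a ha _ (S.min'_mem hne)
    have h3 : a - S.min' hne ≤ ⌊D⌋ := by
      rw [Int.le_floor]; push_cast; exact (le_abs_self _).trans h2
    simp only [Finset.mem_Icc]; omega
  have hc := Finset.card_le_card hsub
  have hf : 0 ≤ ⌊D⌋ := Int.floor_nonneg.2 hD
  have h4 : (S.card : ℤ) ≤ ⌊D⌋ + 1 := by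
    rw [Int.card_Icc] at hc; omega
  have h5 : (S.card : ℝ) ≤ (⌊D⌋ : ℝ) + 1 := by exact_mod_cast h4
  linarith [Int.floor_le D]

/-- Counting along the fibres of a map. -/
lemma card_le_sum_fiber {ι β : Type*} [DecidableEq β] (S : Finset ι) (f : ι → β) (g : β → ℝ)
    (h : ∀ b ∈ S.image f, (((S.filter (fun a => f a = b)).card : ℕ) : ℝ) ≤ g b) :
    (S.card : ℝ) ≤ ∑ b ∈ S.image f, g b := by
  rw [Finset.card_eq_sum_card_image f S]
  push_cast
  exact Finset.sum_le_sum h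

lemma card_le_mul_fiber {ι β : Type*} [DecidableEq β] (S : Finset ι) (f : ι → β) (m n : ℝ) (hn : 0 ≤ n)
    (hm : ((S.image f).card : ℝ) ≤ m)
    (h : ∀ b ∈ S.image f, (((S.filter (fun a => f a = b)).card : ℕ) : ℝ) ≤ n) :
    (S.card : ℝ) ≤ m * n := by
  refine (card_le_sum_fiber S f (fun _ => n) h).trans ?_
  rw [Finset.sum_const, nsmul_eq_mul]
  exact mul_le_mul_of_nonneg_right hm hn

/-- If, in the order prescribed by `ρ`, each coordinate of the points of `S` is determined up to
`D i` by the preceding ones, then `S` has at most `∏ (D i + 1)` points. -/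
lemma card_le_prod {d : ℕ} (S : Finset (Fin d → ℤ)) (ρ : Fin d → ℕ) (D : Fin d → ℝ)
    (hD : ∀ i, 0 ≤ D i)
    (h : ∀ a ∈ S, ∀ b ∈ S, ∀ i, (∀ j, ρ j < ρ i → a j = b j) → |(a i : ℝ) - b i| ≤ D i) :
    (S.card : ℝ) ≤ ∏ i, (D i + 1) := by
  have key : ∀ s : Finset (Fin d), (∀ i ∈ s, ∀ j, ρ j < ρ i → j ∈ s) →
      ((S.image (fun a i => if i ∈ s then a i else 0)).card : ℝ) ≤ ∏ i ∈ s, (D i + 1) := by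
    intro s
    induction s using Finset.induction_on_max_value ρ with
    | empty =>
      intro _
      simp only [Finset.notMem_empty, if_false, Finset.prod_empty]
      exact_mod_cast Finset.card_le_one.2 (by
        simp only [Finset.mem_image]
        rintro _ ⟨a, _, rfl⟩ _ ⟨b, _, rfl⟩; rfl)
    | insert i s his hmax ih =>
      intro hlow
      have hs : ∀ k ∈ s, ∀ j, ρ j < ρ k → j ∈ s := by
        intro k hk j hj
        have := hlow k (Finset.mem_insert_of_mem hk) j hj
        rcases Finset.mem_insert.1 this with rfl | h'
        · exact absurd (hmax k hk) (by omega)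
        · exact h'
      have hi : ∀ j, ρ j < ρ i → j ∈ s := by
        intro j hj
        rcases Finset.mem_insert.1 (hlow i (Finset.mem_insert_self _ _) j hj) with rfl | h'
        · omega
        · exact h'
      rw [Finset.prod_insert his, mul_comm]
      refine card_le_mul_fiber _ (fun a k => if k ∈ s then a k else 0) _ _
        (by linarith [hD i]) ?_ ?_
      · refine le_trans ?_ (ih hs)
        rw [Finset.image_image]
        have hcomp : ((fun (a : Fin d → ℤ) k => if k ∈ s then a k else 0) ∘
            fun (a : Fin d → ℤ) k => if k ∈ insert i s then a k else 0) =
            fun (a : Fin d → ℤ) k => if k ∈ s then a k else 0 := by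
          funext a k
          by_cases hk : k ∈ s <;> simp [hk]
        rw [hcomp]
      · intro b _
        set F := (S.image (fun a k => if k ∈ insert i s then a k else 0)).filter
          (fun a => (fun k => if k ∈ s then a k else 0) = b) with hF
        have hprop : ∀ u ∈ F, ∃ a ∈ S, (∀ k, u k = if k ∈ insert i s then a k else 0) ∧
            ∀ k ∈ s, a k = b k := by
          intro u hu
          rw [hF, Finset.mem_filter, Finset.mem_image] at hu
          obtain ⟨⟨a, ha, rfl⟩, hb⟩ := hu
          refine ⟨a, ha, fun k => rfl, fun k hk => ?_⟩
          have := congrFun hb k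
          simpa [hk] using this
        have hinj : Set.InjOn (fun u : Fin d → ℤ => u i) F := by
          intro u hu v hv huv
          obtain ⟨a, ha, hua, hab⟩ := hprop u hu
          obtain ⟨a', ha', hva, hab'⟩ := hprop v hv
          funext k
          rw [hua k, hva k]
          by_cases hk : k ∈ s
          · simp [hk, hab k hk, hab' k hk]
          · by_cases hki : k = i
            · subst hki
              have := huv
              simp only [hua k, hva k] at this
              exact this
            · simp [hk, hki]
        have := card_int_le (F.image (fun u => u i)) (D i) (hD i) (by
          simp only [Finset.mem_image]
          rintro _ ⟨u, hu, rfl⟩ _ ⟨v, hv, rfl⟩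
          obtain ⟨a, ha, hua, hab⟩ := hprop u hu
          obtain ⟨a', ha', hva, hab'⟩ := hprop v hv
          rw [hua i, hva i]
          simp only [Finset.mem_insert_self, if_true]
          exact h a ha a' ha' i (fun j hj => by rw [hab j (hi j hj), hab' j (hi j hj)]))
        rwa [Finset.card_image_of_injOn hinj] at this
  have := key Finset.univ (fun _ _ _ _ => Finset.mem_univ _)
  simpa using this

lemma exists_abs_eq_norm {d : ℕ} [NeZero d] (x : Fin d → ℤ) : ∃ i, |(x i : ℝ)| = ‖x‖ := by
  obtain ⟨i, hi⟩ := Finite.exists_max (fun i => ‖x i‖)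
  refine ⟨i, le_antisymm ?_ ?_⟩
  · rw [← Int.norm_eq_abs]; exact norm_le_pi_norm x i
  · rw [← Int.norm_eq_abs]; exact (pi_norm_le_iff_of_nonneg (norm_nonneg _)).2 hi

lemma abs_le_norm {d : ℕ} (x : Fin d → ℤ) (i : Fin d) : |(x i : ℝ)| ≤ ‖x‖ := by
  rw [← Int.norm_eq_abs]; exact norm_le_pi_norm x i

lemma one_le_norm {d : ℕ} [NeZero d] {x : Fin d → ℤ} (hx : x ≠ 0) : 1 ≤ ‖x‖ := by
  obtain ⟨i, hi⟩ : ∃ i, x i ≠ 0 := by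
    by_contra! hc; exact hx (funext hc)
  refine le_trans ?_ (abs_le_norm x i)
  exact_mod_cast Int.one_le_abs hi

lemma card_le_pow_mul {d : ℕ} (S : Finset (Fin d → ℤ)) (ρ : Fin d → ℕ) (D : Fin d → ℝ)
    (hD : ∀ i, 0 ≤ D i)
    (h : ∀ a ∈ S, ∀ b ∈ S, ∀ i, (∀ j, ρ j < ρ i → a j = b j) → |(a i : ℝ) - b i| ≤ D i)
    (P w : ℝ) (i₀ : Fin d) (hP : ∀ i, D i + 1 ≤ P * (if i = i₀ then w else 1)) :
    (S.card : ℝ) ≤ P ^ d * w := by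
  refine (card_le_prod S ρ D hD h).trans ?_
  refine (Finset.prod_le_prod (fun i _ => by linarith [hD i]) (fun i _ => hP i)).trans ?_
  rw [Finset.prod_mul_distrib]
  simp

lemma card_box_le {d : ℕ} (S : Finset (Fin d → ℤ)) (R : ℝ) (hR : 1 ≤ R)
    (hS : ∀ a ∈ S, ∀ b ∈ S, ∀ i, |(a i : ℝ) - b i| ≤ R) :
    (S.card : ℝ) ≤ 2 ^ d * R ^ d := by
  refine (card_le_prod S (fun _ => 0) (fun _ => R) (fun _ => by linarith)
    (fun a ha b hb i _ => hS a ha b hb i)).trans ?_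
  rw [← mul_pow]
  simp only [Finset.prod_const, Finset.card_univ, Fintype.card_fin]
  gcongr
  linarith

/-- Lattice points of a box lying in a slab with normal `u`. -/
lemma card_slab_le {d : ℕ} [NeZero d] (S : Finset (Fin d → ℤ)) (R N : ℝ) (hR : 1 ≤ R)
    (hN : 0 ≤ N) (u : Fin d → ℤ) (hu : u ≠ 0)
    (hS : ∀ a ∈ S, ∀ b ∈ S, ∀ i, |(a i : ℝ) - b i| ≤ R)
    (hs : ∀ a ∈ S, ∀ b ∈ S, |∑ i, (u i : ℝ) * ((a i : ℝ) - b i)| ≤ N) :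
    (S.card : ℝ) ≤ 2 ^ d * (R ^ d * ((1 + N / ‖u‖) / R)) := by
  obtain ⟨i₀, hi₀⟩ := exists_abs_eq_norm u
  have hu1 := one_le_norm hu
  have hu0 : 0 < ‖u‖ := by linarith
  have hR0 : 0 < R := by linarith
  have hNu : 0 ≤ N / ‖u‖ := by positivity
  have := card_le_pow_mul S (fun i => if i = i₀ then 1 else 0)
    (fun i => if i = i₀ then N / ‖u‖ else R)
    (fun i => by split_ifs <;> linarith)
    (fun a ha b hb i hij => by
      by_cases h : i = i₀
      · subst h
        simp only [if_true]
        have h1 := hs a ha b hb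
        rw [Fintype.sum_eq_single i (fun j hj => by
          rw [hij j (by simp [hj])]; simp), abs_mul, hi₀] at h1
        rw [le_div_iff₀ hu0]; linarith
      · simp only [h, if_false]; exact hS a ha b hb i)
    (2 * R) ((1 + N / ‖u‖) / R) i₀
    (fun i => by
      by_cases h : i = i₀
      · simp only [h, if_true]
        rw [show 2 * R * ((1 + N / ‖u‖) / R) = 2 * (1 + N / ‖u‖) by field_simp]
        linarith
      · simp only [h, if_false]; linarith)
  rwa [mul_pow, mul_assoc] at this

/-- Lattice points of a box lying in two transverse slabs. -/
lemma card_two_slab_le {d : ℕ} [NeZero d] (S : Finset (Fin d → ℤ)) (R N H : ℝ) (hR : 1 ≤ R)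
    (hN : 0 ≤ N) (hH : 0 < H) (u w : Fin d → ℤ) (hu : u ≠ 0) (hw : ‖w‖ ≤ ‖u‖)
    (hS : ∀ a ∈ S, ∀ b ∈ S, ∀ i, |(a i : ℝ) - b i| ≤ R)
    (hs : ∀ a ∈ S, ∀ b ∈ S, |∑ i, (u i : ℝ) * ((a i : ℝ) - b i)| ≤ N)
    (hs' : ∀ a ∈ S, ∀ b ∈ S, |∑ i, (w i : ℝ) * ((a i : ℝ) - b i)| ≤ N)
    (i₀ j₀ : Fin d) (hi₀ : |(u i₀ : ℝ)| = ‖u‖)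
    (hM : ‖u‖ * H ≤ |(w j₀ : ℝ) * u i₀ - u j₀ * w i₀|) :
    (S.card : ℝ) ≤ 2 ^ d * (R ^ d * ((1 + N / ‖u‖) / R) * ((1 + 2 * N / H) / R)) := by
  have hu1 := one_le_norm hu
  have hu0 : 0 < ‖u‖ := by linarith
  have hR0 : 0 < R := by linarith
  have hNu : 0 ≤ N / ‖u‖ := by positivity
  have hNH : 0 ≤ 2 * N / H := by positivity
  have hne : j₀ ≠ i₀ := by
    rintro rfl
    rw [mul_comm (w j₀ : ℝ), sub_self, abs_zero] at hM
    have : 0 < ‖u‖ * H := by positivity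
    linarith
  have := card_le_prod S (fun i => if i = i₀ then 2 else if i = j₀ then 1 else 0)
    (fun i => if i = i₀ then N / ‖u‖ else if i = j₀ then 2 * N / H else R)
    (fun i => by split_ifs <;> linarith)
    (fun a ha b hb i hij => by
      by_cases h : i = i₀
      · subst h
        simp only [if_true]
        have h1 := hs a ha b hb
        rw [Fintype.sum_eq_single i (fun j hj => by
          rw [hij j (by simp only [hj, if_false, if_true]; split_ifs <;> omega)]; simp),
          abs_mul, hi₀] at h1
        rw [le_div_iff₀ hu0]; linarith
      · by_cases h' : i = j₀
        · subst h'
          simp only [h, if_false, if_true]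
          have hz : ∀ j, j ≠ i₀ ∧ j ≠ i → a j = b j := fun j hj =>
            hij j (by simp [hj.1, hj.2, h])
          have h1 := hs a ha b hb
          have h2 := hs' a ha b hb
          rw [Fintype.sum_eq_add i₀ i (Ne.symm h) (fun j hj => by rw [hz j hj]; simp)] at h1 h2
          have h3 : |(a i : ℝ) - b i| * (‖u‖ * H) ≤ ‖u‖ * N + ‖u‖ * N := by
            calc |(a i : ℝ) - b i| * (‖u‖ * H)
                ≤ |(a i : ℝ) - b i| * |(w i : ℝ) * u i₀ - u i * w i₀| := by gcongr
              _ = |(u i₀ : ℝ) * (w i₀ * ((a i₀ : ℝ) - b i₀) + w i * ((a i : ℝ) - b i)) -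
                  w i₀ * (u i₀ * ((a i₀ : ℝ) - b i₀) + u i * ((a i : ℝ) - b i))| := by
                  rw [← abs_mul]; congr 1; ring
              _ ≤ |(u i₀ : ℝ) * (w i₀ * ((a i₀ : ℝ) - b i₀) + w i * ((a i : ℝ) - b i))| +
                  |w i₀ * (u i₀ * ((a i₀ : ℝ) - b i₀) + u i * ((a i : ℝ) - b i))| :=
                  abs_sub _ _
              _ ≤ ‖u‖ * N + ‖u‖ * N := by
                  rw [abs_mul, abs_mul]
                  have h4 := abs_le_norm u i₀
                  have h5 := (abs_le_norm w i₀).trans hw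
                  gcongr
          rw [le_div_iff₀ hH]
          have : ‖u‖ * (|(a i : ℝ) - b i| * H) ≤ ‖u‖ * (2 * N) := by linarith
          exact le_of_mul_le_mul_left this hu0
        · simp only [h, h', if_false]; exact hS a ha b hb i)
  refine this.trans ?_
  refine (Finset.prod_le_prod (g := fun i => (2 * R) *
      (if i = i₀ then (1 + N / ‖u‖) / R else 1) * (if i = j₀ then (1 + 2 * N / H) / R else 1))
      (fun i _ => by split_ifs <;> linarith) (fun i _ => ?_)).trans ?_
  · by_cases h : i = i₀
    · subst h
      simp only [if_true, Ne.symm hne, if_false]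
      rw [show 2 * R * ((1 + N / ‖u‖) / R) * 1 = 2 * (1 + N / ‖u‖) by field_simp]
      linarith
    · by_cases h' : i = j₀
      · subst h'
        simp only [h, if_true, if_false]
        rw [show 2 * R * 1 * ((1 + 2 * N / H) / R) = 2 * (1 + 2 * N / H) by field_simp]
        linarith
      · simp only [h, h', if_false]; linarith
  · rw [Finset.prod_mul_distrib, Finset.prod_mul_distrib]
    simp only [Finset.prod_const, Finset.card_univ, Fintype.card_fin, Finset.prod_ite_eq',
      Finset.mem_univ, if_true]
    rw [mul_pow]
    apply le_of_eq; ring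

/-- Lattice points of a box close to the line spanned by `x`. -/
lemma card_cone_le {d : ℕ} [NeZero d] (S : Finset (Fin d → ℤ)) (R H : ℝ) (hR : 1 ≤ R)
    (hH : 1 ≤ H) (x : Fin d → ℤ) (hx : x ≠ 0)
    (hS : ∀ a ∈ S, ∀ b ∈ S, ∀ i, |(a i : ℝ) - b i| ≤ R)
    (i₀ : Fin d) (hi₀ : |(x i₀ : ℝ)| = ‖x‖)
    (hs : ∀ a ∈ S, ∀ j, |(a j : ℝ) * x i₀ - x j * a i₀| ≤ ‖x‖ * H) :
    (S.card : ℝ) ≤ 3 ^ d * (H ^ d * (R / H)) := by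
  have hx1 := one_le_norm hx
  have hx0 : 0 < ‖x‖ := by linarith
  have hH0 : 0 < H := by linarith
  have := card_le_pow_mul S (fun i => if i = i₀ then 0 else 1)
    (fun i => if i = i₀ then R else 2 * H)
    (fun i => by split_ifs <;> linarith)
    (fun a ha b hb i hij => by
      by_cases h : i = i₀
      · simp only [h, if_true]; exact hS a ha b hb i₀
      · simp only [h, if_false]
        have h0 : a i₀ = b i₀ := hij i₀ (by simp [h])
        have h1 := hs a ha i
        have h2 := hs b hb i
        rw [h0] at h1
        have h3 : |(a i : ℝ) - b i| * ‖x‖ ≤ 2 * H * ‖x‖ := by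
          rw [← hi₀, ← abs_mul, hi₀]
          calc |((a i : ℝ) - b i) * x i₀| = |((a i : ℝ) * x i₀ - x i * b i₀) -
                ((b i : ℝ) * x i₀ - x i * b i₀)| := by congr 1; ring
            _ ≤ _ := abs_sub _ _
            _ ≤ 2 * H * ‖x‖ := by linarith
        exact le_of_mul_le_mul_right h3 hx0)
    (3 * H) (R / H) i₀
    (fun i => by
      by_cases h : i = i₀
      · simp only [h, if_true]
        rw [show 3 * H * (R / H) = 3 * R by field_simp]
        linarith
      · simp only [h, if_false]; linarith)
  rwa [mul_pow, mul_assoc] at this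

lemma abs_sub_le_sqrt {p q X : ℝ} (h : (0 ≤ p ∧ 0 ≤ q) ∨ (p ≤ 0 ∧ q ≤ 0))
    (hX : |p ^ 2 - q ^ 2| ≤ X) : |p - q| ≤ √X := by
  apply Real.abs_le_sqrt
  refine le_trans ?_ hX
  rw [sq_sub_sq, abs_mul, ← sq_abs, sq, mul_comm]
  gcongr ?_ * _
  rcases h with ⟨h1, h2⟩ | ⟨h1, h2⟩
  · rw [abs_of_nonneg (add_nonneg h1 h2), abs_le]; constructor <;> linarith
  · rw [abs_of_nonpos (add_nonpos h1 h2), abs_le]; constructor <;> linarith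

open Classical in
/-- Lattice points of a box lying in a spherical shell. -/
lemma card_shell_le {d : ℕ} (S : Finset (Fin d → ℤ)) (R N σ : ℝ) (hR : 1 ≤ R)
    (hN : 0 ≤ N) (hσ : 0 < σ) (hS : ∀ a ∈ S, ∀ b ∈ S, ∀ i, |(a i : ℝ) - b i| ≤ R)
    (c : Fin d → ℝ) (A : ℝ) (i₀ i₁ : Fin d) (hi : i₁ ≠ i₀)
    (hs : ∀ a ∈ S, |∑ i, ((a i : ℝ) - c i) ^ 2 - A| ≤ N) :
    (S.card : ℝ) ≤ 8 * (2 ^ d * (R ^ d * ((1 + √(2 * N)) / R) * ((1 + √(2 * N + σ ^ 2)) / R)) +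
      2 ^ d * (R ^ d * ((1 + N / σ) / R))) := by
  have hR0 : 0 < R := by linarith
  have hq1 := Real.sqrt_nonneg (2 * N)
  have hq2 := Real.sqrt_nonneg (2 * N + σ ^ 2)
  have hNσ : 0 ≤ N / σ := by positivity
  refine card_le_mul_fiber S (fun a => (decide (c i₀ ≤ a i₀), decide (c i₁ ≤ a i₁),
    decide (|(a i₀ : ℝ) - c i₀| ≤ σ))) _ _ (by positivity) ?_ ?_
  · have : (Finset.image (fun a : Fin d → ℤ => (decide (c i₀ ≤ a i₀), decide (c i₁ ≤ a i₁),
      decide (|(a i₀ : ℝ) - c i₀| ≤ σ))) S).card ≤ 8 := by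
      refine (Finset.card_le_univ _).trans ?_
      simp
    exact_mod_cast this
  rintro ⟨s₀, s₁, t⟩ -
  set F := S.filter (fun a => (decide (c i₀ ≤ a i₀), decide (c i₁ ≤ a i₁),
    decide (|(a i₀ : ℝ) - c i₀| ≤ σ)) = (s₀, s₁, t)) with hF
  have hFm : ∀ a ∈ F, a ∈ S ∧ decide (c i₀ ≤ a i₀) = s₀ ∧ decide (c i₁ ≤ a i₁) = s₁ ∧
      decide (|(a i₀ : ℝ) - c i₀| ≤ σ) = t := by
    intro a ha
    rw [hF, Finset.mem_filter] at ha
    simpa using ha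
  have hsg₀ : ∀ a ∈ F, ∀ b ∈ F, (0 ≤ (a i₀ : ℝ) - c i₀ ∧ 0 ≤ (b i₀ : ℝ) - c i₀) ∨
      ((a i₀ : ℝ) - c i₀ ≤ 0 ∧ (b i₀ : ℝ) - c i₀ ≤ 0) := by
    intro a ha b hb
    have h1 := (hFm a ha).2.1
    have h2 := (hFm b hb).2.1
    cases s₀ <;> simp at h1 h2
    · right; constructor <;> linarith
    · left; constructor <;> linarith
  have hsg₁ : ∀ a ∈ F, ∀ b ∈ F, (0 ≤ (a i₁ : ℝ) - c i₁ ∧ 0 ≤ (b i₁ : ℝ) - c i₁) ∨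
      ((a i₁ : ℝ) - c i₁ ≤ 0 ∧ (b i₁ : ℝ) - c i₁ ≤ 0) := by
    intro a ha b hb
    have h1 := (hFm a ha).2.2.1
    have h2 := (hFm b hb).2.2.1
    cases s₁ <;> simp at h1 h2
    · right; constructor <;> linarith
    · left; constructor <;> linarith
  have hdiff : ∀ a ∈ F, ∀ b ∈ F, |(∑ i, ((a i : ℝ) - c i) ^ 2) - ∑ i, ((b i : ℝ) - c i) ^ 2| ≤
      2 * N := by
    intro a ha b hb
    have h1 := hs a (hFm a ha).1
    have h2 := hs b (hFm b hb).1
    rw [abs_le] at h1 h2 ⊢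
    constructor <;> linarith
  have hlast : ∀ a ∈ F, ∀ b ∈ F, (∀ j, j ≠ i₀ → a j = b j) →
      |((a i₀ : ℝ) - c i₀) ^ 2 - ((b i₀ : ℝ) - c i₀) ^ 2| ≤ 2 * N := by
    intro a ha b hb hj
    have h1 := hdiff a ha b hb
    rwa [← Finset.sum_sub_distrib, Fintype.sum_eq_single i₀ (fun j hj' => by
      rw [hj j hj']; simp)] at h1
  cases t
  · -- far from the equator
    have hfar : ∀ a ∈ F, σ ≤ |(a i₀ : ℝ) - c i₀| := by
      intro a ha
      have h1 := (hFm a ha).2.2.2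
      simp at h1
      exact h1.le
    have := card_le_pow_mul F (fun i => if i = i₀ then 1 else 0)
      (fun i => if i = i₀ then N / σ else R)
      (fun i => by split_ifs <;> linarith)
      (fun a ha b hb i hij => by
        by_cases h : i = i₀
        · subst h
          simp only [if_true]
          have h1 := hlast a ha b hb (fun j hj => hij j (by simp [hj]))
          have h2 : 2 * σ ≤ |((a i : ℝ) - c i) + ((b i : ℝ) - c i)| := by
            have h3 := hfar a ha
            have h4 := hfar b hb
            rcases hsg₀ a ha b hb with ⟨h5, h6⟩ | ⟨h5, h6⟩
            · rw [abs_of_nonneg h5] at h3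
              rw [abs_of_nonneg h6] at h4
              rw [abs_of_nonneg (add_nonneg h5 h6)]; linarith
            · rw [abs_of_nonpos h5] at h3
              rw [abs_of_nonpos h6] at h4
              rw [abs_of_nonpos (add_nonpos h5 h6)]; linarith
          rw [sq_sub_sq, abs_mul] at h1
          have h7 : 2 * σ * |((a i : ℝ) - c i) - ((b i : ℝ) - c i)| ≤ 2 * N :=
            (mul_le_mul_of_nonneg_right h2 (abs_nonneg _)).trans h1
          rw [sub_sub_sub_cancel_right] at h7
          rw [le_div_iff₀ hσ]; linarith
        · simp only [h, if_false]; exact hS a (hFm a ha).1 b (hFm b hb).1 i)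
      (2 * R) ((1 + N / σ) / R) i₀
      (fun i => by
        by_cases h : i = i₀
        · simp only [h, if_true]
          rw [show 2 * R * ((1 + N / σ) / R) = 2 * (1 + N / σ) by field_simp]
          linarith
        · simp only [h, if_false]; linarith)
    rw [mul_pow, mul_assoc] at this
    refine this.trans (le_add_of_nonneg_left (by positivity))
  · have hnear : ∀ a ∈ F, |(a i₀ : ℝ) - c i₀| ≤ σ := by
      intro a ha
      have h1 := (hFm a ha).2.2.2
      simpa using h1
    have := card_le_prod F (fun i => if i = i₀ then 2 else if i = i₁ then 1 else 0)
      (fun i => if i = i₀ then √(2 * N) else if i = i₁ then √(2 * N + σ ^ 2) else R)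
      (fun i => by split_ifs <;> linarith)
      (fun a ha b hb i hij => by
        by_cases h : i = i₀
        · subst h
          simp only [if_true]
          have h1 := hlast a ha b hb (fun j hj => hij j (by
            simp only [hj, if_false, if_true]; split_ifs <;> omega))
          have h2 := abs_sub_le_sqrt (hsg₀ a ha b hb) h1
          rwa [sub_sub_sub_cancel_right] at h2
        · by_cases h' : i = i₁
          · subst h'
            simp only [h, if_false, if_true]
            have hz : ∀ j, j ≠ i₀ ∧ j ≠ i → a j = b j := fun j hj =>
              hij j (by simp [hj.1, hj.2, h])
            have h1 := hdiff a ha b hb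
            rw [← Finset.sum_sub_distrib, Fintype.sum_eq_add i₀ i (Ne.symm h)
              (fun j hj => by rw [hz j hj]; simp)] at h1
            have h3 := sq_le_sq' (abs_le.1 (hnear a ha)).1 (abs_le.1 (hnear a ha)).2
            have h4 := sq_le_sq' (abs_le.1 (hnear b hb)).1 (abs_le.1 (hnear b hb)).2
            have h5 := sq_nonneg ((a i₀ : ℝ) - c i₀)
            have h6 := sq_nonneg ((b i₀ : ℝ) - c i₀)
            have h2 := abs_sub_le_sqrt (X := 2 * N + σ ^ 2) (hsg₁ a ha b hb) (by
              rw [abs_le] at h1 ⊢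
              constructor <;> linarith)
            rwa [sub_sub_sub_cancel_right] at h2
          · simp only [h, h', if_false]; exact hS a (hFm a ha).1 b (hFm b hb).1 i)
    refine le_trans (this.trans ?_) (le_add_of_nonneg_right (by positivity))
    refine (Finset.prod_le_prod (g := fun i => (2 * R) *
      (if i = i₀ then (1 + √(2 * N)) / R else 1) *
      (if i = i₁ then (1 + √(2 * N + σ ^ 2)) / R else 1))
      (fun i _ => by split_ifs <;> linarith) (fun i _ => ?_)).trans ?_
    · by_cases h : i = i₀
      · subst h
        simp only [if_true, Ne.symm hi, if_false]
        rw [show 2 * R * ((1 + √(2 * N)) / R) * 1 = 2 * (1 + √(2 * N)) by field_simp]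
        linarith
      · by_cases h' : i = i₁
        · subst h'
          simp only [h, if_true, if_false]
          rw [show 2 * R * 1 * ((1 + √(2 * N + σ ^ 2)) / R) = 2 * (1 + √(2 * N + σ ^ 2)) by
            field_simp]
          linarith
        · simp only [h, h', if_false]; linarith
    · rw [Finset.prod_mul_distrib, Finset.prod_mul_distrib]
      simp only [Finset.prod_const, Finset.card_univ, Fintype.card_fin, Finset.prod_ite_eq',
        Finset.mem_univ, if_true]
      rw [mul_pow]
      apply le_of_eq; ring

open Classical in
lemma card_sphere_le {d : ℕ} [NeZero d] (S : Finset (Fin d → ℤ)) (κ : Fin d → ℤ) (m : ℝ)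
    (hm : 1 ≤ m) (hS : ∀ x ∈ S, ‖x - κ‖ = m) :
    (S.card : ℝ) ≤ d * 4 ^ d * (m ^ d / m) := by
  have hm0 : 0 < m := by linarith
  choose idx hidx using fun x : Fin d → ℤ => exists_abs_eq_norm x
  have h := card_le_mul_fiber S (fun x => (idx (x - κ), decide (0 ≤ (x - κ) (idx (x - κ)))))
    (d * 2) (2 ^ d * ((2 * m) ^ d * (1 / (2 * m)))) (by positivity) (by
      have := Finset.card_le_univ
        (S.image (fun x => (idx (x - κ), decide (0 ≤ (x - κ) (idx (x - κ))))))
      simp only [Fintype.card_prod, Fintype.card_fin, Fintype.card_bool] at this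
      exact_mod_cast this) (by
    rintro ⟨i, s⟩ -
    have hF : ∀ x ∈ S.filter (fun x => (idx (x - κ), decide (0 ≤ (x - κ) (idx (x - κ)))) = (i, s)),
        ‖x - κ‖ = m ∧ ((x i : ℝ) - κ i = if s then m else -m) := by
      intro x hx
      simp only [Finset.mem_filter, Prod.mk.injEq] at hx
      obtain ⟨hxS, rfl, rfl⟩ := hx
      refine ⟨hS x hxS, ?_⟩
      have h1 := hidx (x - κ)
      rw [hS x hxS] at h1
      have h2 : (((x - κ) (idx (x - κ)) : ℤ) : ℝ) = (x (idx (x - κ)) : ℝ) - κ (idx (x - κ)) := by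
        simp
      by_cases hs : 0 ≤ (x - κ) (idx (x - κ))
      · have hs' : (0 : ℝ) ≤ (((x - κ) (idx (x - κ)) : ℤ) : ℝ) := by exact_mod_cast hs
        rw [abs_of_nonneg hs'] at h1
        simp only [hs, decide_true, if_true]
        rw [← h2, h1]
      · have hs' : (((x - κ) (idx (x - κ)) : ℤ) : ℝ) ≤ 0 := by exact_mod_cast (not_le.1 hs).le
        rw [abs_of_nonpos hs'] at h1
        simp only [hs, decide_false]
        rw [← h2, ← h1]; simp
    have h1 := card_slab_le _ (2 * m) 0 (by linarith) le_rfl (Pi.single i 1 : Fin d → ℤ) (by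
        simp) (fun a ha b hb j => by
      have h1 := abs_le_norm (a - κ) j
      have h2 := abs_le_norm (b - κ) j
      rw [(hF a ha).1] at h1
      rw [(hF b hb).1] at h2
      simp only [Pi.sub_apply, Int.cast_sub] at h1 h2
      rw [abs_le] at h1 h2 ⊢
      constructor <;> linarith) (fun a ha b hb => by
      rw [Fintype.sum_eq_single i (fun j hj => by simp [hj])]
      have h1 := (hF a ha).2
      have h2 := (hF b hb).2
      have : (a i : ℝ) = b i := by linarith
      simp [this])
    rwa [zero_div, add_zero] at h1)
  refine h.trans (le_of_eq ?_)
  rw [mul_pow, show (4 : ℝ) ^ d = 2 ^ d * 2 ^ d by rw [← mul_pow]; norm_num]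
  field_simp

/-- The inverse square is summable over boxes of lattice points in dimension at least three, with
the expected bound. -/
lemma sum_inv_sq_le {d : ℕ} [NeZero d] (hd : 3 ≤ d) (X : Finset (Fin d → ℤ)) (κ : Fin d → ℤ)
    (R : ℝ) (hR : 1 ≤ R) (hX : ∀ a ∈ X, ∀ b ∈ X, ∀ i, |(a i : ℝ) - b i| ≤ R)
    (hκ : ∀ a ∈ X, a ≠ κ) :
    ∑ x ∈ X, 1 / ‖x - κ‖ ^ 2 ≤ (2 ^ d + d * 4 ^ d) * (R ^ d / R ^ 2) := by
  have hR0 : 0 < R := by linarith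
  have h1n : ∀ x ∈ X, 1 ≤ ‖x - κ‖ := fun x hx => one_le_norm (sub_ne_zero.2 (hκ x hx))
  have hnat : ∀ x : Fin d → ℤ, ((⌊‖x - κ‖⌋₊ : ℕ) : ℝ) = ‖x - κ‖ := by
    intro x
    obtain ⟨i, hi⟩ := exists_abs_eq_norm (x - κ)
    rw [← hi, ← Int.cast_abs, ← Nat.cast_natAbs, Nat.floor_natCast]
  rw [← Finset.sum_filter_add_sum_filter_not X (fun x => R ≤ ‖x - κ‖), add_mul]
  refine add_le_add ?_ ?_
  · refine (Finset.sum_le_card_nsmul _ _ (1 / R ^ 2) (fun x hx => ?_)).trans ?_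
    · have := (Finset.mem_filter.1 hx).2
      gcongr
    · rw [nsmul_eq_mul]
      have h1 := card_box_le (X.filter (fun x => R ≤ ‖x - κ‖)) R hR (fun a ha b hb =>
        hX a (Finset.mem_filter.1 ha).1 b (Finset.mem_filter.1 hb).1)
      calc _ ≤ 2 ^ d * R ^ d * (1 / R ^ 2) := by gcongr
        _ = _ := by ring
  · rw [← Finset.sum_fiberwise_of_maps_to (t := Finset.Icc 1 ⌊R⌋₊) (g := fun x => ⌊‖x - κ‖⌋₊)]
    · have hterm : ∀ m ∈ Finset.Icc 1 ⌊R⌋₊, ∑ x ∈ (X.filter (fun x => ¬ R ≤ ‖x - κ‖)) with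
          ⌊‖x - κ‖⌋₊ = m, 1 / ‖x - κ‖ ^ 2 ≤ d * 4 ^ d * (R ^ d / R ^ 3) := by
        intro m hm
        rw [Finset.mem_Icc] at hm
        have hm1 : (1 : ℝ) ≤ m := by exact_mod_cast hm.1
        have hm0 : (0 : ℝ) < m := by linarith
        have hmR : (m : ℝ) ≤ R := (Nat.le_floor_iff hR0.le).1 hm.2
        have heq : ∀ x ∈ ((X.filter (fun x => ¬ R ≤ ‖x - κ‖)).filter
            (fun x => ⌊‖x - κ‖⌋₊ = m)), ‖x - κ‖ = m := by
          intro x hx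
          rw [← hnat, (Finset.mem_filter.1 hx).2]
        refine (Finset.sum_le_card_nsmul _ _ (1 / (m : ℝ) ^ 2) (fun x hx => by
          rw [heq x hx])).trans ?_
        rw [nsmul_eq_mul]
        have h1 := card_sphere_le _ κ m hm1 heq
        obtain ⟨e, rfl⟩ := Nat.exists_eq_add_of_le hd
        calc _ ≤ ((3 + e : ℕ) : ℝ) * 4 ^ (3 + e) * ((m : ℝ) ^ (3 + e) / m) * (1 / (m : ℝ) ^ 2) := by
              gcongr
          _ = ((3 + e : ℕ) : ℝ) * 4 ^ (3 + e) * (m : ℝ) ^ e := by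
              rw [pow_add (m : ℝ)]; field_simp
          _ ≤ ((3 + e : ℕ) : ℝ) * 4 ^ (3 + e) * R ^ e := by gcongr
          _ = _ := by rw [pow_add R]; field_simp
      refine (Finset.sum_le_sum hterm).trans ?_
      rw [Finset.sum_const, nsmul_eq_mul, Nat.card_Icc, Nat.add_sub_cancel]
      calc (⌊R⌋₊ : ℝ) * (d * 4 ^ d * (R ^ d / R ^ 3)) ≤ R * (d * 4 ^ d * (R ^ d / R ^ 3)) := by
            gcongr; exact Nat.floor_le hR0.le
        _ = _ := by field_simp
    · intro x hx
      rw [Finset.mem_filter] at hx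
      rw [Finset.mem_Icc]
      refine ⟨Nat.le_floor (by simpa using h1n x hx.1), Nat.floor_le_floor (le_of_lt (not_le.1 hx.2))⟩

lemma sum_inv_le {d : ℕ} [NeZero d] (hd : 3 ≤ d) (X : Finset (Fin d → ℤ)) (κ : Fin d → ℤ)
    (R : ℝ) (hR : 1 ≤ R) (hX : ∀ a ∈ X, ∀ b ∈ X, ∀ i, |(a i : ℝ) - b i| ≤ R)
    (hκ : ∀ a ∈ X, a ≠ κ) :
    ∑ x ∈ X, 1 / ‖x - κ‖ ≤ (2 ^ d + d * 4 ^ d) * (R ^ d / R) := by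
  have hR0 : 0 < R := by linarith
  have h1n : ∀ x ∈ X, 1 ≤ ‖x - κ‖ := fun x hx => one_le_norm (sub_ne_zero.2 (hκ x hx))
  have h2 := sum_inv_sq_le hd X κ R hR hX hκ
  have hc := card_box_le X R hR hX
  have h3 : ∑ x ∈ X, 1 / ‖x - κ‖ ≤ ∑ x ∈ X, (1 / 2) * (1 / R + R * (1 / ‖x - κ‖ ^ 2)) := by
    refine Finset.sum_le_sum (fun x hx => ?_)
    have hp : 0 < ‖x - κ‖ := by linarith [h1n x hx]
    rw [div_add' _ _ _ hR0.ne', div_mul_div_comm, div_le_div_iff₀ hp (by positivity)]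
    field_simp
    nlinarith [sq_nonneg (‖x - κ‖ - R)]
  refine h3.trans ?_
  rw [← Finset.mul_sum, Finset.sum_add_distrib, ← Finset.mul_sum, Finset.sum_const, nsmul_eq_mul]
  have h4 : R * ∑ x ∈ X, 1 / ‖x - κ‖ ^ 2 ≤ (2 ^ d + d * 4 ^ d) * (R ^ d / R) := by
    calc _ ≤ R * ((2 ^ d + d * 4 ^ d) * (R ^ d / R ^ 2)) := by gcongr
      _ = _ := by field_simp
  have h5 : (X.card : ℝ) * (1 / R) ≤ (2 ^ d + d * 4 ^ d) * (R ^ d / R) := by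
    calc _ ≤ 2 ^ d * R ^ d * (1 / R) := by gcongr
      _ = 2 ^ d * (R ^ d / R) := by ring
      _ ≤ _ := by
        gcongr
        linarith [show (0 : ℝ) ≤ d * 4 ^ d by positivity]
  linarith

/-- Combining the two previous bounds. -/
lemma sum_weight_le {d : ℕ} [NeZero d] (hd : 3 ≤ d) (X : Finset (Fin d → ℤ)) (κ κ' : Fin d → ℤ)
    (R N G : ℝ) (hR : 1 ≤ R) (hN : 0 ≤ N) (hG : 0 ≤ G)
    (hX : ∀ a ∈ X, ∀ b ∈ X, ∀ i, |(a i : ℝ) - b i| ≤ R)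
    (hκ : ∀ a ∈ X, a ≠ κ) (hκ' : ∀ a ∈ X, a ≠ κ') :
    ∑ x ∈ X, (1 + N / ‖x - κ‖) * (G + N / ‖x - κ'‖) ≤
      (2 ^ d + d * 4 ^ d) * (R ^ d * ((1 + N / R) * (G + N / R))) := by
  have hR0 : 0 < R := by linarith
  set K : ℝ := 2 ^ d + d * 4 ^ d with hK
  have hc : (X.card : ℝ) ≤ K * R ^ d := by
    refine (card_box_le X R hR hX).trans ?_
    gcongr
    linarith [show (0 : ℝ) ≤ d * 4 ^ d by positivity]
  have h1 := sum_inv_le hd X κ R hR hX hκ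
  have h1' := sum_inv_le hd X κ' R hR hX hκ'
  have h2 := sum_inv_sq_le hd X κ R hR hX hκ
  have h2' := sum_inv_sq_le hd X κ' R hR hX hκ'
  rw [← hK] at h1 h1' h2 h2'
  have h3 : ∑ x ∈ X, (1 + N / ‖x - κ‖) * (G + N / ‖x - κ'‖) ≤
      ∑ x ∈ X, (G + N * (1 / ‖x - κ'‖) + N * G * (1 / ‖x - κ‖) +
        (N ^ 2 / 2) * (1 / ‖x - κ‖ ^ 2) + (N ^ 2 / 2) * (1 / ‖x - κ'‖ ^ 2)) := by
    refine Finset.sum_le_sum (fun x _ => ?_)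
    rw [← one_div_pow, ← one_div_pow, div_eq_mul_one_div N ‖x - κ‖,
      div_eq_mul_one_div N ‖x - κ'‖]
    nlinarith [mul_nonneg (sq_nonneg N) (sq_nonneg (1 / ‖x - κ‖ - 1 / ‖x - κ'‖))]
  refine h3.trans ?_
  simp only [Finset.sum_add_distrib, ← Finset.mul_sum, Finset.sum_const, nsmul_eq_mul]
  calc _ ≤ K * R ^ d * G + N * (K * (R ^ d / R)) + N * G * (K * (R ^ d / R)) +
        N ^ 2 / 2 * (K * (R ^ d / R ^ 2)) + N ^ 2 / 2 * (K * (R ^ d / R ^ 2)) := by gcongr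
    _ = _ := by field_simp; ring

lemma card_triple_le {ι V : Type*} [DecidableEq V] (S : Finset ι) (x y z : ι → V)
    (hinj : ∀ s ∈ S, ∀ t ∈ S, x s = x t → y s = y t → z s = z t → s = t) (g h : V → ℝ)
    (hh : ∀ v, 0 ≤ h v)
    (hy : ∀ v ∈ S.image x, (((S.filter (fun s => x s = v)).image y).card : ℝ) ≤ g v)
    (hz : ∀ v ∈ S.image x, ∀ w,
      (((S.filter (fun s => x s = v ∧ y s = w)).image z).card : ℝ) ≤ h v) :
    (S.card : ℝ) ≤ ∑ v ∈ S.image x, g v * h v := by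
  refine card_le_sum_fiber S x _ (fun v hv => ?_)
  refine card_le_mul_fiber _ y _ _ (hh v) (hy v hv) (fun w _ => ?_)
  rw [Finset.filter_filter]
  refine le_trans ?_ (hz v hv w)
  rw [Finset.card_image_of_injOn]
  intro s hs t ht hst
  rw [Finset.mem_coe, Finset.mem_filter] at hs ht
  exact hinj s hs.1 t ht.1 (hs.2.1.trans ht.2.1.symm) (hs.2.2.trans ht.2.2.symm) hst

lemma card_exceptional_le {ι : Type*} {d : ℕ} [NeZero d] (S : Finset ι) (x y z : ι → Fin d → ℤ)
    (hinj : ∀ s ∈ S, ∀ t ∈ S, x s = x t → y s = y t → z s = z t → s = t)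
    (R : ℝ) (hR : 1 ≤ R)
    (hby : ∀ s ∈ S, ∀ t ∈ S, ∀ i, |(y s i : ℝ) - y t i| ≤ R)
    (hbz : ∀ s ∈ S, ∀ t ∈ S, ∀ i, |(z s i : ℝ) - z t i| ≤ R)
    (κ : Fin d → ℤ) (hx : ∀ s ∈ S, x s = κ) :
    (S.card : ℝ) ≤ 4 ^ d * (R ^ d * R ^ d) := by
  have hR0 : 0 < R := by linarith
  have hc := card_triple_le S x y z hinj (fun _ => 2 ^ d * R ^ d) (fun _ => 2 ^ d * R ^ d)
    (fun _ => by positivity)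
    (fun v _ => card_box_le _ R hR (by
      simp only [Finset.mem_image, Finset.mem_filter]
      rintro _ ⟨s, ⟨hs, _⟩, rfl⟩ _ ⟨t, ⟨ht, _⟩, rfl⟩
      exact hby s hs t ht))
    (fun v _ w => card_box_le _ R hR (by
      simp only [Finset.mem_image, Finset.mem_filter]
      rintro _ ⟨s, ⟨hs, _⟩, rfl⟩ _ ⟨t, ⟨ht, _⟩, rfl⟩
      exact hbz s hs t ht))
  rw [Finset.sum_const, nsmul_eq_mul] at hc
  have h1 : (S.image x).card ≤ 1 := Finset.card_le_one.2 (by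
    simp only [Finset.mem_image]
    rintro _ ⟨s, hs, rfl⟩ _ ⟨t, ht, rfl⟩
    rw [hx s hs, hx t ht])
  have h1' : ((S.image x).card : ℝ) ≤ 1 := by exact_mod_cast h1
  calc _ ≤ _ := hc
    _ ≤ 1 * (2 ^ d * R ^ d * (2 ^ d * R ^ d)) := by gcongr
    _ = _ := by
      rw [show (4 : ℝ) ^ d = 2 ^ d * 2 ^ d by rw [← mul_pow]; norm_num]; ring

lemma card_parallel_le {ι : Type*} {d : ℕ} [NeZero d] (hd : 3 ≤ d) (S : Finset ι)
    (x y z : ι → Fin d → ℤ)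
    (hinj : ∀ s ∈ S, ∀ t ∈ S, x s = x t → y s = y t → z s = z t → s = t)
    (R N H : ℝ) (hR : 1 ≤ R) (hN : 0 ≤ N) (hH : 1 ≤ H)
    (hbx : ∀ s ∈ S, ∀ t ∈ S, ∀ i, |(x s i : ℝ) - x t i| ≤ R)
    (hby : ∀ s ∈ S, ∀ t ∈ S, ∀ i, |(y s i : ℝ) - y t i| ≤ R)
    (hbz : ∀ s ∈ S, ∀ t ∈ S, ∀ i, |(z s i : ℝ) - z t i| ≤ R)
    (hxz : ∀ s ∈ S, ∀ t ∈ S, x s = x t → y s = y t →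
      |∑ i, (x s i : ℝ) * ((z s i : ℝ) - z t i)| ≤ N)
    (idx : (Fin d → ℤ) → Fin d) (hidx : ∀ v : Fin d → ℤ, |(v (idx v) : ℝ)| = ‖v‖)
    (hx0 : ∀ s ∈ S, x s ≠ 0)
    (hpar : ∀ s ∈ S, ∀ j, |(y s j : ℝ) * x s (idx (x s)) - x s j * y s (idx (x s))| ≤ ‖x s‖ * H) :
    (S.card : ℝ) ≤ 6 ^ d * (2 ^ d + d * 4 ^ d) *
      (R ^ d * R ^ d * (1 + N / R) * (H ^ d / H)) := by
  have hR0 : 0 < R := by linarith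
  have hH0 : 0 < H := by linarith
  have hX0 : ∀ v ∈ S.image x, v ≠ 0 := by
    simp only [Finset.mem_image]
    rintro _ ⟨s, hs, rfl⟩
    exact hx0 s hs
  have hX : ∀ a ∈ S.image x, ∀ b ∈ S.image x, ∀ i, |(a i : ℝ) - b i| ≤ R := by
    simp only [Finset.mem_image]
    rintro _ ⟨s, hs, rfl⟩ _ ⟨t, ht, rfl⟩
    exact hbx s hs t ht
  have hc := card_triple_le S x y z hinj (fun _ => 3 ^ d * (H ^ d * (R / H)))
    (fun v => 2 ^ d * (R ^ d * ((1 + N / ‖v‖) / R)))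
    (fun _ => by positivity)
    (fun v hv => card_cone_le _ R H hR hH v (hX0 v hv) (by
      simp only [Finset.mem_image, Finset.mem_filter]
      rintro _ ⟨s, ⟨hs, _⟩, rfl⟩ _ ⟨t, ⟨ht, _⟩, rfl⟩
      exact hby s hs t ht) (idx v) (hidx v) (by
      simp only [Finset.mem_image, Finset.mem_filter]
      rintro _ ⟨s, ⟨hs, rfl⟩, rfl⟩
      exact hpar s hs))
    (fun v hv w => card_slab_le _ R N hR hN v (hX0 v hv) (by
      simp only [Finset.mem_image, Finset.mem_filter]
      rintro _ ⟨s, ⟨hs, _⟩, rfl⟩ _ ⟨t, ⟨ht, _⟩, rfl⟩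
      exact hbz s hs t ht) (by
      simp only [Finset.mem_image, Finset.mem_filter]
      rintro _ ⟨s, ⟨hs, hs1, hs2⟩, rfl⟩ _ ⟨t, ⟨ht, ht1, ht2⟩, rfl⟩
      rw [← hs1]
      exact hxz s hs t ht (hs1.trans ht1.symm) (hs2.trans ht2.symm)))
  refine hc.trans ?_
  have h2 := sum_weight_le hd (S.image x) 0 0 R N 1 hR hN zero_le_one hX hX0 hX0
  have h3 : ∑ v ∈ S.image x, (1 + N / ‖v‖) ≤ (2 ^ d + d * 4 ^ d) * (R ^ d * (1 + N / R)) := by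
    have hc1 := card_box_le (S.image x) R hR hX
    have hc2 := sum_inv_le hd (S.image x) 0 R hR hX hX0
    simp only [sub_zero] at hc2
    simp only [div_eq_mul_one_div N]
    rw [Finset.sum_add_distrib, ← Finset.mul_sum, Finset.sum_const, nsmul_eq_mul]
    calc _ ≤ 2 ^ d * R ^ d * 1 + N * ((2 ^ d + d * 4 ^ d) * (R ^ d / R)) := by gcongr
      _ ≤ (2 ^ d + d * 4 ^ d) * R ^ d * 1 + N * ((2 ^ d + d * 4 ^ d) * (R ^ d / R)) := by
        gcongr
        linarith [show (0 : ℝ) ≤ d * 4 ^ d by positivity]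
      _ = _ := by ring
  calc ∑ v ∈ S.image x, 3 ^ d * (H ^ d * (R / H)) * (2 ^ d * (R ^ d * ((1 + N / ‖v‖) / R)))
      = 6 ^ d * (H ^ d / H) * R ^ d * ∑ v ∈ S.image x, (1 + N / ‖v‖) := by
        rw [Finset.mul_sum]
        refine Finset.sum_congr rfl (fun v _ => ?_)
        rw [show (6 : ℝ) ^ d = 3 ^ d * 2 ^ d by rw [← mul_pow]; norm_num]
        field_simp
    _ ≤ 6 ^ d * (H ^ d / H) * R ^ d * ((2 ^ d + d * 4 ^ d) * (R ^ d * (1 + N / R))) := by gcongr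
    _ = _ := by ring

lemma card_transverse_le {ι : Type*} {d : ℕ} [NeZero d] (hd : 3 ≤ d) (S : Finset ι)
    (x y z : ι → Fin d → ℤ)
    (hinj : ∀ s ∈ S, ∀ t ∈ S, x s = x t → y s = y t → z s = z t → s = t)
    (R N H G : ℝ) (hR : 1 ≤ R) (hN : 0 ≤ N) (hH : 1 ≤ H) (hG : 0 ≤ G) (κ : Fin d → ℤ)
    (hbx : ∀ s ∈ S, ∀ t ∈ S, ∀ i, |(x s i : ℝ) - x t i| ≤ R)
    (hbz : ∀ s ∈ S, ∀ t ∈ S, ∀ i, |(z s i : ℝ) - z t i| ≤ R)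
    (hxz : ∀ s ∈ S, ∀ t ∈ S, x s = x t → y s = y t →
      |∑ i, (x s i : ℝ) * ((z s i : ℝ) - z t i)| ≤ N)
    (hyz : ∀ s ∈ S, ∀ t ∈ S, x s = x t → y s = y t →
      |∑ i, (y s i : ℝ) * ((z s i : ℝ) - z t i)| ≤ N)
    (hE : ∀ v, v ≠ κ → (((S.filter (fun s => x s = v)).image y).card : ℝ) ≤
      8 * 2 ^ d * (R ^ d * ((G + N / ‖v - κ‖) / R)))
    (idx : (Fin d → ℤ) → Fin d) (hidx : ∀ v : Fin d → ℤ, |(v (idx v) : ℝ)| = ‖v‖)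
    (hx0 : ∀ s ∈ S, x s ≠ 0) (hy0 : ∀ s ∈ S, y s ≠ 0) (hxκ : ∀ s ∈ S, x s ≠ κ)
    (hpar : ∀ s ∈ S, ‖y s‖ ≤ ‖x s‖ → ∃ j,
      ‖x s‖ * H ≤ |(y s j : ℝ) * x s (idx (x s)) - x s j * y s (idx (x s))|)
    (hpar' : ∀ s ∈ S, ‖x s‖ ≤ ‖y s‖ → ∃ j,
      ‖y s‖ * H ≤ |(x s j : ℝ) * y s (idx (y s)) - y s j * x s (idx (y s))|) :
    (S.card : ℝ) ≤ 8 * 4 ^ d * (2 ^ d + d * 4 ^ d) *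
      (R ^ d * R ^ d * R ^ d / R ^ 3 * (1 + N / R) * (G + N / R) * (1 + 2 * N / H)) := by
  have hR0 : 0 < R := by linarith
  have hH0 : 0 < H := by linarith
  have hX0 : ∀ v ∈ S.image x, v ≠ 0 := by
    simp only [Finset.mem_image]
    rintro _ ⟨s, hs, rfl⟩
    exact hx0 s hs
  have hXκ : ∀ v ∈ S.image x, v ≠ κ := by
    simp only [Finset.mem_image]
    rintro _ ⟨s, hs, rfl⟩
    exact hxκ s hs
  have hX : ∀ a ∈ S.image x, ∀ b ∈ S.image x, ∀ i, |(a i : ℝ) - b i| ≤ R := by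
    simp only [Finset.mem_image]
    rintro _ ⟨s, hs, rfl⟩ _ ⟨t, ht, rfl⟩
    exact hbx s hs t ht
  have hc := card_triple_le S x y z hinj
    (fun v => 8 * 2 ^ d * (R ^ d * ((G + N / ‖v - κ‖) / R)))
    (fun v => 2 ^ d * (R ^ d * ((1 + N / ‖v‖) / R) * ((1 + 2 * N / H) / R)))
    (fun _ => by positivity)
    (fun v hv => hE v (hXκ v hv))
    (fun v hv w => by
      set F := (S.filter (fun s => x s = v ∧ y s = w)).image z with hF
      rcases (S.filter (fun s => x s = v ∧ y s = w)).eq_empty_or_nonempty with hemp | ⟨s₀, hs₀⟩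
      · rw [hF, hemp]
        simp only [Finset.image_empty, Finset.card_empty, Nat.cast_zero]
        positivity
      rw [Finset.mem_filter] at hs₀
      obtain ⟨hs₀, rfl, rfl⟩ := hs₀
      have hFb : ∀ a ∈ F, ∀ b ∈ F, ∀ i, |(a i : ℝ) - b i| ≤ R := by
        simp only [hF, Finset.mem_image, Finset.mem_filter]
        rintro _ ⟨s, ⟨hs, _⟩, rfl⟩ _ ⟨t, ⟨ht, _⟩, rfl⟩
        exact hbz s hs t ht
      have hFx : ∀ a ∈ F, ∀ b ∈ F, |∑ i, (x s₀ i : ℝ) * ((a i : ℝ) - b i)| ≤ N := by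
        simp only [hF, Finset.mem_image, Finset.mem_filter]
        rintro _ ⟨s, ⟨hs, hs1, hs2⟩, rfl⟩ _ ⟨t, ⟨ht, ht1, ht2⟩, rfl⟩
        rw [← hs1]
        exact hxz s hs t ht (hs1.trans ht1.symm) (hs2.trans ht2.symm)
      have hFy : ∀ a ∈ F, ∀ b ∈ F, |∑ i, (y s₀ i : ℝ) * ((a i : ℝ) - b i)| ≤ N := by
        simp only [hF, Finset.mem_image, Finset.mem_filter]
        rintro _ ⟨s, ⟨hs, hs1, hs2⟩, rfl⟩ _ ⟨t, ⟨ht, ht1, ht2⟩, rfl⟩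
        rw [← hs2]
        exact hyz s hs t ht (hs1.trans ht1.symm) (hs2.trans ht2.symm)
      rcases le_total ‖y s₀‖ ‖x s₀‖ with hle | hle
      · obtain ⟨j, hj⟩ := hpar s₀ hs₀ hle
        exact card_two_slab_le F R N H hR hN hH0 (x s₀) (y s₀) (hx0 s₀ hs₀) hle hFb hFx hFy _ j
          (hidx _) hj
      · obtain ⟨j, hj⟩ := hpar' s₀ hs₀ hle
        have hx1 := one_le_norm (hx0 s₀ hs₀)
        have hxp : 0 < ‖x s₀‖ := by linarith
        refine (card_two_slab_le F R N H hR hN hH0 (y s₀) (x s₀) (hy0 s₀ hs₀) hle hFb hFy hFx _ j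
          (hidx _) hj).trans ?_
        gcongr)
  refine hc.trans ?_
  have h2 := sum_weight_le hd (S.image x) 0 κ R N G hR hN hG hX hX0 hXκ
  simp only [sub_zero] at h2
  calc _ = 8 * 4 ^ d * (R ^ d * R ^ d / R ^ 3 * (1 + 2 * N / H)) *
        ∑ v ∈ S.image x, (1 + N / ‖v‖) * (G + N / ‖v - κ‖) := by
        rw [Finset.mul_sum]
        refine Finset.sum_congr rfl (fun v _ => ?_)
        rw [show (4 : ℝ) ^ d = 2 ^ d * 2 ^ d by rw [← mul_pow]; norm_num]
        field_simp
    _ ≤ 8 * 4 ^ d * (R ^ d * R ^ d / R ^ 3 * (1 + 2 * N / H)) *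
        ((2 ^ d + d * 4 ^ d) * (R ^ d * ((1 + N / R) * (G + N / R)))) := by gcongr
    _ = _ := by ring

open Classical in
/-- Counting triples of lattice points, the third of which lies in two slabs whose normals are
the first two, while the second lies in a thin set prescribed by the first. -/
lemma card_triples_le {ι : Type*} {d : ℕ} (hd : 3 ≤ d) (S : Finset ι)
    (x y z : ι → Fin d → ℤ)
    (hinj : ∀ s ∈ S, ∀ t ∈ S, x s = x t → y s = y t → z s = z t → s = t)
    (R N H G : ℝ) (hR : 1 ≤ R) (hN : 0 ≤ N) (hH : 1 ≤ H) (hG : 0 ≤ G) (κ : Fin d → ℤ)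
    (hbx : ∀ s ∈ S, ∀ t ∈ S, ∀ i, |(x s i : ℝ) - x t i| ≤ R)
    (hby : ∀ s ∈ S, ∀ t ∈ S, ∀ i, |(y s i : ℝ) - y t i| ≤ R)
    (hbz : ∀ s ∈ S, ∀ t ∈ S, ∀ i, |(z s i : ℝ) - z t i| ≤ R)
    (hxz : ∀ s ∈ S, ∀ t ∈ S, x s = x t → y s = y t →
      |∑ i, (x s i : ℝ) * ((z s i : ℝ) - z t i)| ≤ N)
    (hyz : ∀ s ∈ S, ∀ t ∈ S, x s = x t → y s = y t →
      |∑ i, (y s i : ℝ) * ((z s i : ℝ) - z t i)| ≤ N)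
    (hE : ∀ v, v ≠ κ → (((S.filter (fun s => x s = v)).image y).card : ℝ) ≤
      8 * 2 ^ d * (R ^ d * ((G + N / ‖v - κ‖) / R))) :
    (S.card : ℝ) ≤ 8 * 6 ^ d * (2 ^ d + d * 4 ^ d) *
      (R ^ d * R ^ d * R ^ d / R ^ 3 * (1 + N / R) * (G + N / R) * (1 + 2 * N / H) +
        R ^ d * R ^ d * (1 + N / R) * (H ^ d / H)) := by
  have : NeZero d := ⟨by omega⟩
  have hR0 : 0 < R := by linarith
  have hH0 : 0 < H := by linarith
  choose idx hidx using fun v : Fin d → ℤ => exists_abs_eq_norm v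
  set P₀ : ι → Prop := fun s => x s = 0
  set P₁ : ι → Prop := fun s => x s = κ
  set P₂ : ι → Prop := fun s => y s = 0
  set P₃ : ι → Prop := fun s => ∀ j,
    |(y s j : ℝ) * x s (idx (x s)) - x s j * y s (idx (x s))| ≤ ‖x s‖ * H
  set P₄ : ι → Prop := fun s => ∀ j,
    |(x s j : ℝ) * y s (idx (y s)) - y s j * x s (idx (y s))| ≤ ‖y s‖ * H
  have hsplit : S ⊆ S.filter P₀ ∪ (S.filter P₁ ∪ (S.filter P₂ ∪
      (S.filter (fun s => ¬ P₀ s ∧ P₃ s) ∪ (S.filter (fun s => ¬ P₂ s ∧ P₄ s) ∪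
      S.filter (fun s => ¬ P₀ s ∧ ¬ P₁ s ∧ ¬ P₂ s ∧ ¬ P₃ s ∧ ¬ P₄ s))))) := by
    intro s hs
    simp only [Finset.mem_union, Finset.mem_filter, hs, true_and]
    tauto
  have hcard : (S.card : ℝ) ≤ (S.filter P₀).card + ((S.filter P₁).card + ((S.filter P₂).card +
      ((S.filter (fun s => ¬ P₀ s ∧ P₃ s)).card + ((S.filter (fun s => ¬ P₂ s ∧ P₄ s)).card +
      (S.filter (fun s => ¬ P₀ s ∧ ¬ P₁ s ∧ ¬ P₂ s ∧ ¬ P₃ s ∧ ¬ P₄ s)).card)))) := by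
    refine le_trans (Nat.cast_le.2 ((Finset.card_le_card hsplit).trans
      ((Finset.card_union_le _ _).trans (Nat.add_le_add_left ((Finset.card_union_le _ _).trans
      (Nat.add_le_add_left ((Finset.card_union_le _ _).trans (Nat.add_le_add_left
      ((Finset.card_union_le _ _).trans (Nat.add_le_add_left (Finset.card_union_le _ _) _))
      _)) _)) _)))) ?_
    push_cast
    exact le_rfl
  have b₀ := card_exceptional_le (S.filter P₀) x y z
    (fun s hs t ht => hinj s (Finset.filter_subset _ _ hs) t (Finset.filter_subset _ _ ht)) R hR
    (fun s hs t ht => hby s (Finset.filter_subset _ _ hs) t (Finset.filter_subset _ _ ht))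
    (fun s hs t ht => hbz s (Finset.filter_subset _ _ hs) t (Finset.filter_subset _ _ ht))
    0 (fun s hs => (Finset.mem_filter.1 hs).2)
  have b₁ := card_exceptional_le (S.filter P₁) x y z
    (fun s hs t ht => hinj s (Finset.filter_subset _ _ hs) t (Finset.filter_subset _ _ ht)) R hR
    (fun s hs t ht => hby s (Finset.filter_subset _ _ hs) t (Finset.filter_subset _ _ ht))
    (fun s hs t ht => hbz s (Finset.filter_subset _ _ hs) t (Finset.filter_subset _ _ ht))
    κ (fun s hs => (Finset.mem_filter.1 hs).2)
  have b₂ := card_exceptional_le (S.filter P₂) y x z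
    (fun s hs t ht h1 h2 => hinj s (Finset.filter_subset _ _ hs) t (Finset.filter_subset _ _ ht)
      h2 h1) R hR
    (fun s hs t ht => hbx s (Finset.filter_subset _ _ hs) t (Finset.filter_subset _ _ ht))
    (fun s hs t ht => hbz s (Finset.filter_subset _ _ hs) t (Finset.filter_subset _ _ ht))
    0 (fun s hs => (Finset.mem_filter.1 hs).2)
  have b₃ := card_parallel_le hd (S.filter (fun s => ¬ P₀ s ∧ P₃ s)) x y z
    (fun s hs t ht => hinj s (Finset.filter_subset _ _ hs) t (Finset.filter_subset _ _ ht))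
    R N H hR hN hH
    (fun s hs t ht => hbx s (Finset.filter_subset _ _ hs) t (Finset.filter_subset _ _ ht))
    (fun s hs t ht => hby s (Finset.filter_subset _ _ hs) t (Finset.filter_subset _ _ ht))
    (fun s hs t ht => hbz s (Finset.filter_subset _ _ hs) t (Finset.filter_subset _ _ ht))
    (fun s hs t ht => hxz s (Finset.filter_subset _ _ hs) t (Finset.filter_subset _ _ ht))
    idx hidx (fun s hs => (Finset.mem_filter.1 hs).2.1) (fun s hs => (Finset.mem_filter.1 hs).2.2)
  have b₄ := card_parallel_le hd (S.filter (fun s => ¬ P₂ s ∧ P₄ s)) y x z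
    (fun s hs t ht h1 h2 => hinj s (Finset.filter_subset _ _ hs) t (Finset.filter_subset _ _ ht)
      h2 h1)
    R N H hR hN hH
    (fun s hs t ht => hby s (Finset.filter_subset _ _ hs) t (Finset.filter_subset _ _ ht))
    (fun s hs t ht => hbx s (Finset.filter_subset _ _ hs) t (Finset.filter_subset _ _ ht))
    (fun s hs t ht => hbz s (Finset.filter_subset _ _ hs) t (Finset.filter_subset _ _ ht))
    (fun s hs t ht h1 h2 => hyz s (Finset.filter_subset _ _ hs) t (Finset.filter_subset _ _ ht)
      h2 h1)
    idx hidx (fun s hs => (Finset.mem_filter.1 hs).2.1) (fun s hs => (Finset.mem_filter.1 hs).2.2)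
  have b₅ := card_transverse_le hd
    (S.filter (fun s => ¬ P₀ s ∧ ¬ P₁ s ∧ ¬ P₂ s ∧ ¬ P₃ s ∧ ¬ P₄ s)) x y z
    (fun s hs t ht => hinj s (Finset.filter_subset _ _ hs) t (Finset.filter_subset _ _ ht))
    R N H G hR hN hH hG κ
    (fun s hs t ht => hbx s (Finset.filter_subset _ _ hs) t (Finset.filter_subset _ _ ht))
    (fun s hs t ht => hbz s (Finset.filter_subset _ _ hs) t (Finset.filter_subset _ _ ht))
    (fun s hs t ht => hxz s (Finset.filter_subset _ _ hs) t (Finset.filter_subset _ _ ht))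
    (fun s hs t ht => hyz s (Finset.filter_subset _ _ hs) t (Finset.filter_subset _ _ ht))
    (fun v hv => le_trans (Nat.cast_le.2 (Finset.card_le_card (Finset.image_subset_image
      (Finset.filter_subset_filter _ (Finset.filter_subset _ _))))) (hE v hv))
    idx hidx (fun s hs => (Finset.mem_filter.1 hs).2.1)
    (fun s hs => (Finset.mem_filter.1 hs).2.2.2.1) (fun s hs => (Finset.mem_filter.1 hs).2.2.1)
    (fun s hs _ => by
      have := (Finset.mem_filter.1 hs).2.2.2.2.1
      simp only [P₃, not_forall, not_le] at this
      exact this.imp (fun _ h => h.le))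
    (fun s hs _ => by
      have := (Finset.mem_filter.1 hs).2.2.2.2.2
      simp only [P₄, not_forall, not_le] at this
      exact this.imp (fun _ h => h.le))
  set X := R ^ d * R ^ d * R ^ d / R ^ 3 * (1 + N / R) * (G + N / R) * (1 + 2 * N / H)
  set Y := R ^ d * R ^ d * (1 + N / R) * (H ^ d / H) with hY
  set K : ℝ := 2 ^ d + d * 4 ^ d with hK
  have hX0 : 0 ≤ X := by positivity
  have hY0 : R ^ d * R ^ d ≤ Y := by
    have h1 : 1 ≤ 1 + N / R := by
      have : 0 ≤ N / R := by positivity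
      linarith
    have h2 : 1 ≤ H ^ d / H := by
      rw [le_div_iff₀ hH0, one_mul]
      exact le_self_pow₀ hH (by omega)
    calc R ^ d * R ^ d = R ^ d * R ^ d * 1 * 1 := by ring
      _ ≤ Y := by rw [hY]; gcongr
  have hYn : 0 ≤ Y := by positivity
  have hK1 : 1 ≤ K := by
    have h1 : (1 : ℝ) ≤ 2 ^ d := one_le_pow₀ (by norm_num)
    linarith [show (0 : ℝ) ≤ d * 4 ^ d by positivity]
  have h46 : (4 : ℝ) ^ d ≤ 6 ^ d := by gcongr; norm_num
  have e₁ : (4 : ℝ) ^ d * (R ^ d * R ^ d) ≤ 6 ^ d * K * Y := by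
    calc (4 : ℝ) ^ d * (R ^ d * R ^ d) ≤ 6 ^ d * Y := by gcongr
      _ = 6 ^ d * 1 * Y := by ring
      _ ≤ _ := by gcongr
  have e₂ : 8 * (4 : ℝ) ^ d * K * X ≤ 8 * 6 ^ d * K * X := by gcongr
  have e₃ : 0 ≤ 6 ^ d * K * Y := by positivity
  linarith

/-- The constant of the counting bound. -/
def countConst (d : ℕ) : ℝ := 8 * 6 ^ d * (2 ^ d + d * 4 ^ d) * (70 * 64 ^ d + 2 * 16 ^ d)

lemma weights_le_rpow {d : ℕ} (hd : 3 ≤ d) {γ L D G : ℝ} (hγ : 0 < γ) (hγ' : γ < 1) (hL : 1 ≤ L)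
    (hD : 1 ≤ D) (hG0 : 0 ≤ G) (hG : G ≤ 6 * D * L ^ max 0 (1 - 1.5 * γ)) {R N H : ℝ}
    (hR : R = 4 * L) (hN : N = 2 * D * L ^ (2 - 2 * γ))
    (hH : H = L ^ (1 - γ - 0.01 * min γ (1 - γ))) :
    8 * 6 ^ d * (2 ^ d + d * 4 ^ d) *
      (R ^ d * R ^ d * R ^ d / R ^ 3 * (1 + N / R) * (G + N / R) * (1 + 2 * N / H) +
        R ^ d * R ^ d * (1 + N / R) * (H ^ d / H)) ≤
      countConst d * D ^ 3 * L ^ (3 * ((d : ℝ) - γ) - 1.01 * min γ (1 - γ)) := by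
  have hL0 : 0 < L := by linarith
  set γ₀ := min γ (1 - γ) with hγ₀
  set m := max 0 (1 - 1.5 * γ) with hm
  have hg1 : γ₀ ≤ γ := min_le_left _ _
  have hg2 : γ₀ ≤ 1 - γ := min_le_right _ _
  have hg3 : 0 < γ₀ := lt_min hγ (by linarith)
  have hm0 : 0 ≤ m := le_max_left _ _
  have hm1 : 1 - 1.5 * γ ≤ m := le_max_right _ _
  have hd' : (3 : ℝ) ≤ d := by exact_mod_cast hd
  have mono : ∀ {a b : ℝ}, a ≤ b → L ^ a ≤ L ^ b := fun h => Real.rpow_le_rpow_of_exponent_le hL h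
  have one_le : ∀ {a : ℝ}, 0 ≤ a → 1 ≤ L ^ a := fun h => Real.one_le_rpow hL h
  have hNR : N / R = D / 2 * L ^ (1 - 2 * γ) := by
    rw [hN, hR, show (2 - 2 * γ) = (1 - 2 * γ) + 1 by ring, Real.rpow_add hL0, Real.rpow_one]
    field_simp
    norm_num
  have h1 : 1 + N / R ≤ 2 * D * L ^ (1 - γ - γ₀) := by
    rw [hNR]
    have a1 : L ^ (1 - 2 * γ) ≤ L ^ (1 - γ - γ₀) := mono (by linarith)
    have a2 : 1 ≤ D * L ^ (1 - γ - γ₀) := by nlinarith [one_le (show 0 ≤ 1 - γ - γ₀ by linarith)]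
    nlinarith
  have h2 : G + N / R ≤ 7 * D * L ^ m := by
    rw [hNR]
    have a1 : L ^ (1 - 2 * γ) ≤ L ^ m := mono (by linarith)
    have a2 : 0 < L ^ m := Real.rpow_pos_of_pos hL0 _
    nlinarith
  have h3 : 1 + 2 * N / H ≤ 5 * D * L ^ (1 - γ + 0.01 * γ₀) := by
    have a1 : 2 * N / H = 4 * D * L ^ (1 - γ + 0.01 * γ₀) := by
      rw [hN, hH, show 2 - 2 * γ = (1 - γ + 0.01 * γ₀) + (1 - γ - 0.01 * γ₀) by ring,
        Real.rpow_add hL0]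
      have := Real.rpow_pos_of_pos hL0 (1 - γ - 0.01 * γ₀)
      field_simp
      norm_num
    rw [a1]
    have a2 : 1 ≤ D * L ^ (1 - γ + 0.01 * γ₀) := by
      nlinarith [one_le (show 0 ≤ 1 - γ + 0.01 * γ₀ by linarith)]
    linarith
  have h4 : R ^ d * R ^ d * R ^ d / R ^ 3 ≤ 64 ^ d * L ^ (3 * (d : ℝ) - 3) := by
    have a1 : L ^ (3 * (d : ℝ) - 3) = L ^ d * L ^ d * L ^ d / L ^ 3 := by
      rw [Real.rpow_sub hL0, show (3 : ℝ) * d = d + d + d by ring, Real.rpow_add hL0,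
        Real.rpow_add hL0, Real.rpow_natCast, show (3 : ℝ) = (3 : ℕ) by norm_num,
        Real.rpow_natCast]
    rw [a1, hR, show (64 : ℝ) ^ d = 4 ^ d * 4 ^ d * 4 ^ d by
      rw [← mul_pow, ← mul_pow]; norm_num]
    simp only [mul_pow]
    rw [show 4 ^ d * L ^ d * (4 ^ d * L ^ d) * (4 ^ d * L ^ d) / (4 ^ 3 * L ^ 3) =
      4 ^ d * 4 ^ d * 4 ^ d * (L ^ d * L ^ d * L ^ d / L ^ 3) * (1 / 64) by
        field_simp; norm_num]
    have : 0 ≤ 4 ^ d * 4 ^ d * 4 ^ d * (L ^ d * L ^ d * L ^ d / L ^ 3) := by positivity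
    linarith
  have h5 : R ^ d * R ^ d = 16 ^ d * L ^ (2 * (d : ℝ)) := by
    rw [hR, two_mul, Real.rpow_add hL0, Real.rpow_natCast, mul_pow,
      show (16 : ℝ) ^ d = 4 ^ d * 4 ^ d by rw [← mul_pow]; norm_num]
    ring
  have h6 : H ^ d / H = L ^ ((1 - γ - 0.01 * γ₀) * ((d : ℝ) - 1)) := by
    rw [hH, mul_sub _ (d : ℝ), mul_one, Real.rpow_sub hL0 (_ * (d : ℝ)),
      Real.rpow_mul hL0.le _ (d : ℝ), Real.rpow_natCast]
  set E := 3 * ((d : ℝ) - γ) - 1.01 * γ₀ with hE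
  have hH0 : 0 < H := hH ▸ Real.rpow_pos_of_pos hL0 _
  have hN0 : 0 ≤ N := by
    rw [hN]
    have := Real.rpow_pos_of_pos hL0 (2 - 2 * γ)
    positivity
  have hR0 : 0 < R := by linarith
  have hP := fun a => Real.rpow_pos_of_pos hL0 a
  have e1 : R ^ d * R ^ d * R ^ d / R ^ 3 * (1 + N / R) * (G + N / R) * (1 + 2 * N / H) ≤
      70 * 64 ^ d * D ^ 3 * L ^ E := by
    have := hP (3 * (d : ℝ) - 3)
    have := hP (1 - γ - γ₀)
    have := hP m
    have := hP (1 - γ + 0.01 * γ₀)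
    calc _ ≤ 64 ^ d * L ^ (3 * (d : ℝ) - 3) * (2 * D * L ^ (1 - γ - γ₀)) * (7 * D * L ^ m) *
          (5 * D * L ^ (1 - γ + 0.01 * γ₀)) := by gcongr
      _ = 70 * 64 ^ d * D ^ 3 * L ^ ((3 * (d : ℝ) - 3) + (1 - γ - γ₀) + m +
          (1 - γ + 0.01 * γ₀)) := by
        rw [Real.rpow_add hL0 _ (1 - γ + 0.01 * γ₀), Real.rpow_add hL0 _ m,
          Real.rpow_add hL0 _ (1 - γ - γ₀)]
        ring
      _ ≤ _ := by
        have : m ≤ 1 - γ - 0.02 * γ₀ := max_le (by linarith) (by linarith)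
        exact mul_le_mul_of_nonneg_left (mono (by rw [hE]; linarith)) (by positivity)
  have e2 : R ^ d * R ^ d * (1 + N / R) * (H ^ d / H) ≤ 2 * 16 ^ d * D ^ 3 * L ^ E := by
    rw [h5, h6]
    have := hP (2 * (d : ℝ))
    have := hP (1 - γ - γ₀)
    have := hP ((1 - γ - 0.01 * γ₀) * ((d : ℝ) - 1))
    calc _ ≤ 16 ^ d * L ^ (2 * (d : ℝ)) * (2 * D * L ^ (1 - γ - γ₀)) *
          L ^ ((1 - γ - 0.01 * γ₀) * ((d : ℝ) - 1)) := by gcongr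
      _ = 2 * 16 ^ d * D ^ 1 * L ^ (2 * (d : ℝ) + (1 - γ - γ₀) +
          (1 - γ - 0.01 * γ₀) * ((d : ℝ) - 1)) := by
        rw [Real.rpow_add hL0 _ (_ * ((d : ℝ) - 1)), Real.rpow_add hL0 (2 * (d : ℝ))]; ring
      _ ≤ _ := by
        have a1 : D ^ 1 ≤ D ^ 3 := pow_le_pow_right₀ hD (by norm_num)
        have a2 : 0 ≤ ((d : ℝ) - 3) * (γ + 0.01 * γ₀) :=
          mul_nonneg (by linarith) (by linarith)
        refine mul_le_mul (by gcongr) (mono ?_) (hP _).le (by positivity)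
        rw [hE]
        nlinarith
  unfold countConst
  calc _ ≤ 8 * 6 ^ d * (2 ^ d + d * 4 ^ d) * (70 * 64 ^ d * D ^ 3 * L ^ E +
        2 * 16 ^ d * D ^ 3 * L ^ E) := by gcongr
    _ = _ := by ring

lemma shell_weight_le {γ L D : ℝ} (hγ' : γ < 1) (hL : 1 ≤ L)
    (hD : 1 ≤ D) {R N σ : ℝ}
    (hR : R = 4 * L) (hN : N = 2 * D * L ^ (2 - 2 * γ)) (hσ : σ = L ^ (1 - γ / 2))
    (hγ : 0 < γ) :
    (1 + √(2 * N)) * (1 + √(2 * N + σ ^ 2)) / R + 1 + N / σ ≤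
      6 * D * L ^ max 0 (1 - 1.5 * γ) := by
  have hL0 : 0 < L := by linarith
  have hP := fun a => Real.rpow_pos_of_pos hL0 a
  set m := max 0 (1 - 1.5 * γ) with hm
  have hm0 : 0 ≤ m := le_max_left _ _
  have hm1 : 1 - 1.5 * γ ≤ m := le_max_right _ _
  have hσ0 : 0 < σ := hσ ▸ hP _
  have hD0 : 0 < D := by linarith
  set r := √D with hr
  have hr1 : 1 ≤ r := Real.one_le_sqrt.2 hD
  have hrr : r * r = D := Real.mul_self_sqrt hD0.le
  set P := L ^ (1 - γ) with hPdef
  have hP1 : 1 ≤ P := Real.one_le_rpow hL (by linarith)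
  have hPσ : P ≤ σ := by
    rw [hσ]
    exact Real.rpow_le_rpow_of_exponent_le hL (by linarith)
  have hPP : L ^ (2 - 2 * γ) = P * P := by
    rw [hPdef, ← Real.rpow_add hL0]
    congr 1
    ring
  have hs : √(2 * N) = 2 * r * P := by
    rw [hN, hPP, ← hrr, Real.sqrt_eq_iff_mul_self_eq (by positivity) (by positivity)]
    ring
  have hs' : √(2 * N + σ ^ 2) ≤ 2 * r * P + σ := by
    rw [← hs]
    have h0 := Real.sqrt_nonneg (2 * N)
    have hN0 : 0 ≤ 2 * N := by rw [hN]; have := hP (2 - 2 * γ); positivity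
    rw [Real.sqrt_le_left (by positivity)]
    nlinarith [Real.mul_self_sqrt hN0, mul_nonneg h0 hσ0.le]
  have hPσL : P * σ / L = L ^ (1 - 1.5 * γ) := by
    rw [hPdef, hσ, ← Real.rpow_add hL0, div_eq_iff hL0.ne', ← Real.rpow_add_one hL0.ne']
    congr 1
    ring
  have hNσ : N / σ = 2 * D * L ^ (1 - 1.5 * γ) := by
    rw [hN, hσ, div_eq_iff (hP _).ne', mul_assoc (2 * D) (L ^ (1 - 1.5 * γ)),
      ← Real.rpow_add hL0]
    congr 2
    ring
  have hmono : L ^ (1 - 1.5 * γ) ≤ L ^ m := Real.rpow_le_rpow_of_exponent_le hL hm1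
  have hone : 1 ≤ L ^ m := Real.one_le_rpow hL hm0
  have ha : 1 + √(2 * N) ≤ 3 * r * P := by
    rw [hs]
    nlinarith
  have hb : 1 + √(2 * N + σ ^ 2) ≤ 4 * r * σ := by
    have h1 : r * P ≤ r * σ := by gcongr
    have h2 : 1 ≤ r * P := by nlinarith
    have h3 : σ ≤ r * σ := by nlinarith
    linarith
  have hab : (1 + √(2 * N)) * (1 + √(2 * N + σ ^ 2)) / R ≤ 3 * D * L ^ (1 - 1.5 * γ) := by
    rw [hR, ← hPσL, ← hrr]
    have h2 := Real.sqrt_nonneg (2 * N + σ ^ 2)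
    calc _ ≤ (3 * r * P) * (4 * r * σ) / (4 * L) := by gcongr
      _ = _ := by field_simp
  rw [hNσ]
  nlinarith

lemma ZLat.sub_mem {d : ℕ} {L : ℝ} {x y : EuclideanSpace ℝ (Fin d)} (hx : x ∈ ZLat d L)
    (hy : y ∈ ZLat d L) : x - y ∈ ZLat d L := by
  intro i
  obtain ⟨m, hm⟩ := hx i
  obtain ⟨n, hn⟩ := hy i
  exact ⟨m - n, by rw [PiLp.sub_apply, hm, hn]; push_cast; ring⟩

lemma ZLat.neg_mem {d : ℕ} {L : ℝ} {x : EuclideanSpace ℝ (Fin d)} (hx : x ∈ ZLat d L) :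
    -x ∈ ZLat d L := by
  intro i
  obtain ⟨m, hm⟩ := hx i
  exact ⟨-m, by rw [PiLp.neg_apply, hm]; push_cast; ring⟩

/-- Integer coordinates of a point of the rescaled lattice. -/
def latticeCoord {d : ℕ} (L : ℝ) (x : EuclideanSpace ℝ (Fin d)) : Fin d → ℤ :=
  fun i => round (L * x i)

lemma latticeCoord_cast {d : ℕ} {L : ℝ} (hL : 0 < L) {x : EuclideanSpace ℝ (Fin d)}
    (hx : x ∈ ZLat d L) (i : Fin d) : (latticeCoord L x i : ℝ) = L * x i := by
  obtain ⟨m, hm⟩ := hx i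
  rw [latticeCoord, hm, mul_div_cancel₀ _ hL.ne', round_intCast]

lemma latticeCoord_injOn {d : ℕ} {L : ℝ} (hL : 0 < L) {x y : EuclideanSpace ℝ (Fin d)}
    (hx : x ∈ ZLat d L) (hy : y ∈ ZLat d L) (h : latticeCoord L x = latticeCoord L y) :
    x = y := by
  ext i
  have h1 := latticeCoord_cast hL hx i
  rw [h, latticeCoord_cast hL hy i] at h1
  exact (mul_left_cancel₀ hL.ne' h1).symm

lemma latticeCoord_sub {d : ℕ} {L : ℝ} (hL : 0 < L) {x y : EuclideanSpace ℝ (Fin d)}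
    (hx : x ∈ ZLat d L) (hy : y ∈ ZLat d L) :
    latticeCoord L (x - y) = latticeCoord L x - latticeCoord L y := by
  ext i
  have : (latticeCoord L (x - y) i : ℝ) = ((latticeCoord L x - latticeCoord L y) i : ℤ) := by
    rw [latticeCoord_cast hL (ZLat.sub_mem hx hy), Pi.sub_apply, Int.cast_sub,
      latticeCoord_cast hL hx, latticeCoord_cast hL hy, PiLp.sub_apply, mul_sub]
  exact_mod_cast this

lemma sum_latticeCoord {d : ℕ} {L : ℝ} (hL : 0 < L) {x y z : EuclideanSpace ℝ (Fin d)}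
    (hx : x ∈ ZLat d L) (hy : y ∈ ZLat d L) (hz : z ∈ ZLat d L) :
    ∑ i, (latticeCoord L x i : ℝ) * ((latticeCoord L y i : ℝ) - latticeCoord L z i) =
      L ^ 2 * ⟪x, y - z⟫ := by
  simp only [latticeCoord_cast hL hx, latticeCoord_cast hL hy, latticeCoord_cast hL hz,
    PiLp.inner_apply, Finset.mul_sum, PiLp.sub_apply, RCLike.inner_apply, conj_trivial]
  exact Finset.sum_congr rfl (fun i _ => by ring)

lemma abs_latticeCoord_sub_le {d : ℕ} {L : ℝ} (hL : 0 < L) {x y : EuclideanSpace ℝ (Fin d)}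
    (hx : x ∈ ZLat d L) (hy : y ∈ ZLat d L) (h : ‖x - y‖ ≤ 4) (i : Fin d) :
    |(latticeCoord L x i : ℝ) - latticeCoord L y i| ≤ 4 * L := by
  rw [latticeCoord_cast hL hx, latticeCoord_cast hL hy, ← mul_sub, abs_mul, abs_of_pos hL]
  have h1 : |x i - y i| ≤ ‖x - y‖ := by
    have := PiLp.norm_apply_le (x - y) i
    rwa [PiLp.sub_apply, Real.norm_eq_abs] at this
  nlinarith

open Classical in
lemma ncard_triples_le {ι : Type*} {d : ℕ} (hd : 3 ≤ d) {γ L D : ℝ} (hγ : 0 < γ) (hγ' : γ < 1)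
    (hL : 1 ≤ L) (hD : 1 ≤ D) (S : Set ι) (x y z : ι → EuclideanSpace ℝ (Fin d))
    (hinj : ∀ s ∈ S, ∀ t ∈ S, x s = x t → y s = y t → z s = z t → s = t)
    (hx : ∀ s ∈ S, x s ∈ ZLat d L) (hy : ∀ s ∈ S, y s ∈ ZLat d L) (hz : ∀ s ∈ S, z s ∈ ZLat d L)
    (hbx : ∀ s ∈ S, ∀ t ∈ S, ‖x s - x t‖ ≤ 4) (hby : ∀ s ∈ S, ∀ t ∈ S, ‖y s - y t‖ ≤ 4)
    (hbz : ∀ s ∈ S, ∀ t ∈ S, ‖z s - z t‖ ≤ 4)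
    (hxz : ∀ s ∈ S, ∀ t ∈ S, x s = x t → y s = y t →
      |⟪x s, z s - z t⟫| ≤ 2 * (D * L ^ (-(2 * γ))))
    (hyz : ∀ s ∈ S, ∀ t ∈ S, x s = x t → y s = y t →
      |⟪y s, z s - z t⟫| ≤ 2 * (D * L ^ (-(2 * γ))))
    (hE : (∃ K ∈ ZLat d L, ∀ s ∈ S, ∀ t ∈ S, x s = x t →
        |⟪x s - K, y s - y t⟫| ≤ 2 * (D * L ^ (-(2 * γ)))) ∨
      ∃ (c : EuclideanSpace ℝ (Fin d) → EuclideanSpace ℝ (Fin d))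
        (A : EuclideanSpace ℝ (Fin d) → ℝ), ∀ s ∈ S,
        |‖y s - c (x s)‖ ^ 2 - A (x s)| ≤ 2 * (D * L ^ (-(2 * γ)))) :
    (S.ncard : ℝ) ≤
      countConst d * D ^ 3 * L ^ (3 * ((d : ℝ) - γ) - 1.01 * min γ (1 - γ)) := by
  have hL0 : 0 < L := by linarith
  have : NeZero d := ⟨by omega⟩
  have hP := fun a => Real.rpow_pos_of_pos hL0 a
  by_cases hfin : S.Finite
  swap
  · rw [Set.Infinite.ncard hfin, countConst]
    have := hP (3 * ((d : ℝ) - γ) - 1.01 * min γ (1 - γ))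
    simp only [Nat.cast_zero]
    positivity
  lift S to Finset ι using hfin
  rw [Set.ncard_coe_finset]
  simp only [Finset.mem_coe] at *
  set N := 2 * D * L ^ (2 - 2 * γ) with hN
  have hNe : L ^ 2 * (2 * (D * L ^ (-(2 * γ)))) = N := by
    rw [hN, show 2 - 2 * γ = 2 + -(2 * γ) by ring, Real.rpow_add hL0,
      show (2 : ℝ) = (2 : ℕ) by norm_num, Real.rpow_natCast]
    ring
  have hN0 : 0 ≤ N := by have := hP (2 - 2 * γ); positivity
  have hscale : ∀ r : ℝ, |r| ≤ 2 * (D * L ^ (-(2 * γ))) → |L ^ 2 * r| ≤ N := by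
    intro r hr
    rw [abs_mul, abs_of_pos (by positivity : 0 < L ^ 2), ← hNe]
    gcongr
  have hinjc : ∀ s ∈ S, ∀ t ∈ S, latticeCoord L (x s) = latticeCoord L (x t) → x s = x t :=
    fun s hs t ht h => latticeCoord_injOn hL0 (hx s hs) (hx t ht) h
  have hinjy : ∀ s ∈ S, ∀ t ∈ S, latticeCoord L (y s) = latticeCoord L (y t) → y s = y t :=
    fun s hs t ht h => latticeCoord_injOn hL0 (hy s hs) (hy t ht) h
  have hcy : ∀ s ∈ S, ∀ t ∈ S, ∀ i,
      |(latticeCoord L (y s) i : ℝ) - latticeCoord L (y t) i| ≤ 4 * L := fun s hs t ht =>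
    abs_latticeCoord_sub_le hL0 (hy s hs) (hy t ht) (hby s hs t ht)
  have hR : 1 ≤ 4 * L := by linarith
  have hH : 1 ≤ L ^ (1 - γ - 0.01 * min γ (1 - γ)) := Real.one_le_rpow hL (by
    have : min γ (1 - γ) ≤ 1 - γ := min_le_right _ _
    linarith)
  have main : ∀ (G : ℝ) (κ : Fin d → ℤ), 0 ≤ G → G ≤ 6 * D * L ^ max 0 (1 - 1.5 * γ) →
      (∀ v, v ≠ κ → (((S.filter (fun s => latticeCoord L (x s) = v)).image
        (fun s => latticeCoord L (y s))).card : ℝ) ≤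
        8 * 2 ^ d * ((4 * L) ^ d * ((G + N / ‖v - κ‖) / (4 * L)))) →
      (S.card : ℝ) ≤
        countConst d * D ^ 3 * L ^ (3 * ((d : ℝ) - γ) - 1.01 * min γ (1 - γ)) := by
    intro G κ hG0 hG h
    refine le_trans ?_ (weights_le_rpow hd hγ hγ' hL hD hG0 hG rfl hN rfl)
    refine card_triples_le hd S (fun s => latticeCoord L (x s)) (fun s => latticeCoord L (y s))
      (fun s => latticeCoord L (z s)) (fun s hs t ht h1 h2 h3 => ?_) _ N _ G hR hN0 hH hG0 κ
      (fun s hs t ht => abs_latticeCoord_sub_le hL0 (hx s hs) (hx t ht) (hbx s hs t ht)) hcy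
      (fun s hs t ht => abs_latticeCoord_sub_le hL0 (hz s hs) (hz t ht) (hbz s hs t ht))
      (fun s hs t ht h1 h2 => ?_) (fun s hs t ht h1 h2 => ?_) h
    · exact hinj s hs t ht (hinjc s hs t ht h1) (hinjy s hs t ht h2)
        (latticeCoord_injOn hL0 (hz s hs) (hz t ht) h3)
    · rw [sum_latticeCoord hL0 (hx s hs) (hz s hs) (hz t ht)]
      exact hscale _ (hxz s hs t ht (hinjc s hs t ht h1) (hinjy s hs t ht h2))
    · rw [sum_latticeCoord hL0 (hy s hs) (hz s hs) (hz t ht)]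
      exact hscale _ (hyz s hs t ht (hinjc s hs t ht h1) (hinjy s hs t ht h2))
  have hpos : ∀ G κ, 0 ≤ G → ∀ v : Fin d → ℤ,
      0 ≤ 8 * 2 ^ d * ((4 * L) ^ d * ((G + N / ‖v - κ‖) / (4 * L))) := by
    intro G κ hG v
    positivity
  have hcyf : ∀ v, ∀ a ∈ (S.filter (fun s => latticeCoord L (x s) = v)).image
        (fun s => latticeCoord L (y s)), ∀ b ∈ (S.filter (fun s => latticeCoord L (x s) = v)).image
        (fun s => latticeCoord L (y s)), ∀ i, |(a i : ℝ) - b i| ≤ 4 * L := by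
    simp only [Finset.mem_image, Finset.mem_filter]
    rintro v _ ⟨s, ⟨hs, _⟩, rfl⟩ _ ⟨t, ⟨ht, _⟩, rfl⟩
    exact hcy s hs t ht
  rcases hE with ⟨K, hK, hE⟩ | ⟨c, A, hE⟩
  · refine main 1 (latticeCoord L K) zero_le_one ?_ (fun v hv => ?_)
    · have := Real.one_le_rpow hL (le_max_left 0 (1 - 1.5 * γ))
      nlinarith
    · refine (card_slab_le _ (4 * L) N hR hN0 (v - latticeCoord L K) (sub_ne_zero.2 hv)
        (hcyf v) ?_).trans ?_
      · simp only [Finset.mem_image, Finset.mem_filter]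
        rintro _ ⟨s, ⟨hs, rfl⟩, rfl⟩ _ ⟨t, ⟨ht, hst⟩, rfl⟩
        rw [← latticeCoord_sub hL0 (hx s hs) hK,
          sum_latticeCoord hL0 (ZLat.sub_mem (hx s hs) hK) (hy s hs) (hy t ht)]
        exact hscale _ (hE s hs t ht (hinjc s hs t ht hst.symm))
      · have : 0 ≤ 2 ^ d * ((4 * L) ^ d * ((1 + N / ‖v - latticeCoord L K‖) / (4 * L))) := by
          positivity
        linarith
  · have hσ0 := hP (1 - γ / 2)
    set σ := L ^ (1 - γ / 2) with hσ
    have hq1 := Real.sqrt_nonneg (2 * N)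
    have hq2 := Real.sqrt_nonneg (2 * N + σ ^ 2)
    have hG0 : 0 ≤ (1 + √(2 * N)) * (1 + √(2 * N + σ ^ 2)) / (4 * L) + 1 + N / σ := by positivity
    refine main _ 0 hG0 (shell_weight_le hγ' hL hD rfl hN hσ hγ) (fun v _ => ?_)
    rcases (S.filter (fun s => latticeCoord L (x s) = v)).eq_empty_or_nonempty with he | ⟨s₀, hs₀⟩
    · rw [he]
      simpa using hpos _ 0 hG0 v
    rw [Finset.mem_filter] at hs₀
    refine (card_shell_le _ (4 * L) N σ hR hN0 hσ0 (hcyf v) (fun i => L * c (x s₀) i)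
      (L ^ 2 * A (x s₀)) ⟨0, by omega⟩ ⟨1, by omega⟩ (by simp) ?_).trans ?_
    · simp only [Finset.mem_image, Finset.mem_filter]
      rintro _ ⟨s, ⟨hs, hsv⟩, rfl⟩
      have h1 : x s = x s₀ := hinjc s hs s₀ hs₀.1 (hsv.trans hs₀.2.symm)
      have h2 := hscale _ (hE s hs)
      rw [h1, mul_sub, EuclideanSpace.real_norm_sq_eq, Finset.mul_sum] at h2
      simp only [latticeCoord_cast hL0 (hy s hs), ← mul_sub, mul_pow]
      simpa only [PiLp.sub_apply] using h2
    · have h3 : 0 ≤ N / ‖v - 0‖ := by positivity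
      calc _ = 8 * 2 ^ d * ((4 * L) ^ d * (((1 + √(2 * N)) * (1 + √(2 * N + σ ^ 2)) / (4 * L) +
            1 + N / σ + 0) / (4 * L))) := by field_simp; ring
        _ ≤ _ := by gcongr

/-- For fixed `u`, the point `w` is confined to a slab whose normal is a lattice translate
of `u`. -/
def SlabRel {ι : Type*} {d : ℕ} (L r : ℝ) (S : Set ι) (u w : ι → EuclideanSpace ℝ (Fin d)) :
    Prop :=
  ∃ K ∈ ZLat d L, ∀ s ∈ S, ∀ t ∈ S, u s = u t → |⟪u s - K, w s - w t⟫| ≤ r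

lemma ZLat.sign_smul_mem {d : ℕ} {L s : ℝ} (hs : s = 1 ∨ s = -1) {x : EuclideanSpace ℝ (Fin d)}
    (hx : x ∈ ZLat d L) : s • x ∈ ZLat d L := by
  rcases hs with rfl | rfl
  · rwa [one_smul]
  · rw [neg_one_smul]
    exact ZLat.neg_mem hx

lemma slabRel_of_vertex {ι : Type*} {d : ℕ} {L ε e s t β : ℝ} {S : Set ι}
    {k x y : ι → EuclideanSpace ℝ (Fin d)} {K : EuclideanSpace ℝ (Fin d)}
    (he : e = 1 ∨ e = -1) (hs : s = 1 ∨ s = -1) (het : e = -t) (hK : K ∈ ZLat d L)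
    (hlin : ∀ q ∈ S, e • k q + s • x q + t • y q = K)
    (hquad : ∀ q ∈ S, |e * ‖k q‖ ^ 2 + s * ‖x q‖ ^ 2 + t * ‖y q‖ ^ 2 - β| ≤ ε) :
    SlabRel L ε S x y := by
  refine ⟨s • K, ZLat.sign_smul_mem hs hK, fun p hp q hq hpq => ?_⟩
  obtain rfl : t = -e := by linarith
  have hee : e * e = 1 := by rcases he with rfl | rfl <;> norm_num
  have hss : s * s = 1 := by rcases hs with rfl | rfl <;> norm_num
  have key : ∀ r ∈ S, e * ‖k r‖ ^ 2 + s * ‖x r‖ ^ 2 + -e * ‖y r‖ ^ 2 =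
      e * ‖K - s • x r‖ ^ 2 + s * ‖x r‖ ^ 2 - 2 * s * ⟪x r - s • K, y r⟫ := by
    intro r hr
    have h1 : k r = y r + e • (K - s • x r) := by
      rw [← hlin r hr]
      have : e • (e • k r + s • x r + -e • y r - s • x r) = (e * e) • (k r - y r) := by module
      rw [this, hee]
      module
    have h2 : K - s • x r = (-s) • (x r - s • K) := by
      have : (-s) • (x r - s • K) = (s * s) • K - s • x r := by module
      rw [this, hss, one_smul]
    have h3 : ‖k r‖ ^ 2 = ‖y r‖ ^ 2 + 2 * (e * (-s * ⟪x r - s • K, y r⟫)) +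
        ‖K - s • x r‖ ^ 2 := by
      rw [h1, norm_add_sq_real, norm_smul, mul_pow, Real.norm_eq_abs, sq_abs, sq e, hee, one_mul,
        inner_smul_right, real_inner_comm]
      nth_rewrite 1 [h2]
      rw [inner_smul_left, conj_trivial]
    rw [h3]
    linear_combination (-2 * s * ⟪x r - s • K, y r⟫) * hee
  have h1 := hquad p hp
  have h2 := hquad q hq
  rw [key p hp] at h1
  rw [key q hq, ← hpq] at h2
  rw [inner_sub_right]
  rw [abs_le] at *
  rcases hs with rfl | rfl <;> constructor <;> linarith

lemma cyclic_vertex {d : ℕ} {s β ε : ℝ} (hs : s = 1 ∨ s = -1)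
    {k a c K : EuclideanSpace ℝ (Fin d)} (h : s • k + s • a - s • c = K)
    (hq : |s * ‖k‖ ^ 2 + s * ‖a‖ ^ 2 - s * ‖c‖ ^ 2 - β| ≤ ε) :
    |⟪c - a, s • K - a⟫ - (s * β - ‖s • K‖ ^ 2) / 2| ≤ ε / 2 := by
  have hss : s * s = 1 := by rcases hs with rfl | rfl <;> norm_num
  have h1 : k = s • K + (c - a) := by
    rw [← h]
    have : s • (s • k + s • a - s • c) = (s * s) • (k + a - c) := by module
    rw [this, hss]
    module
  have h2 : ‖k‖ ^ 2 + ‖a‖ ^ 2 - ‖c‖ ^ 2 = ‖s • K‖ ^ 2 + 2 * ⟪c - a, s • K - a⟫ := by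
    rw [h1, norm_add_sq_real, norm_sub_sq_real, inner_sub_right (c - a), inner_sub_left c a a,
      real_inner_self_eq_norm_sq, real_inner_comm (s • K)]
    ring
  rw [show s * ‖k‖ ^ 2 + s * ‖a‖ ^ 2 - s * ‖c‖ ^ 2 - β = s * (‖k‖ ^ 2 + ‖a‖ ^ 2 - ‖c‖ ^ 2) - β by
    ring, h2] at hq
  rw [abs_le] at *
  rcases hs with rfl | rfl <;> constructor <;> linarith

section

variable {ι : Type*} {d : ℕ} (hd : 3 ≤ d) {γ L D : ℝ} (hγ : 0 < γ) (hγ' : γ < 1)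
  (hL : 1 ≤ L) (hD : 1 ≤ D) (S : Set ι) (a b c : ι → EuclideanSpace ℝ (Fin d))
  (hinj : ∀ s ∈ S, ∀ t ∈ S, a s = a t → b s = b t → c s = c t → s = t)
  (ha : ∀ s ∈ S, a s ∈ ZLat d L) (hb : ∀ s ∈ S, b s ∈ ZLat d L) (hc : ∀ s ∈ S, c s ∈ ZLat d L)
  (hba : ∀ s ∈ S, ∀ t ∈ S, ‖a s - a t‖ ≤ 2) (hbb : ∀ s ∈ S, ∀ t ∈ S, ‖b s - b t‖ ≤ 2)
  (hbc : ∀ s ∈ S, ∀ t ∈ S, ‖c s - c t‖ ≤ 2)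

include hd hγ hγ' hL hD hinj ha hb hc hba hbb hbc

lemma ncard_le_of_sink (hac : SlabRel L (D * L ^ (-(2 * γ))) S a c)
    (hbc' : SlabRel L (D * L ^ (-(2 * γ))) S b c) (hab : SlabRel L (D * L ^ (-(2 * γ))) S a b) :
    (S.ncard : ℝ) ≤
      countConst d * D ^ 3 * L ^ (3 * ((d : ℝ) - γ) - 1.01 * min γ (1 - γ)) := by
  obtain ⟨K₁, hK₁, h₁⟩ := hac
  obtain ⟨K₂, hK₂, h₂⟩ := hbc'
  obtain ⟨K₃, hK₃, h₃⟩ := hab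
  have hε : 0 ≤ D * L ^ (-(2 * γ)) := by
    have := Real.rpow_pos_of_pos (by linarith : 0 < L) (-(2 * γ))
    positivity
  refine ncard_triples_le hd hγ hγ' hL hD S (fun s => a s - K₁) (fun s => b s - K₂) c
    (fun s hs t ht e1 e2 e3 => hinj s hs t ht (sub_left_inj.1 e1) (sub_left_inj.1 e2) e3)
    (fun s hs => ZLat.sub_mem (ha s hs) hK₁) (fun s hs => ZLat.sub_mem (hb s hs) hK₂) hc
    (fun s hs t ht => ?_) (fun s hs t ht => ?_)
    (fun s hs t ht => (hbc s hs t ht).trans (by norm_num))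
    (fun s hs t ht e1 e2 => ?_) (fun s hs t ht e1 e2 => ?_)
    (Or.inl ⟨K₃ - K₁, ZLat.sub_mem hK₃ hK₁, fun s hs t ht e1 => ?_⟩)
  · simpa only [sub_sub_sub_cancel_right] using (hba s hs t ht).trans (by norm_num)
  · simpa only [sub_sub_sub_cancel_right] using (hbb s hs t ht).trans (by norm_num)
  · exact (h₁ s hs t ht (sub_left_inj.1 e1)).trans (by linarith)
  · exact (h₂ s hs t ht (sub_left_inj.1 e2)).trans (by linarith)
  · simpa only [sub_sub_sub_cancel_right] using
      (h₃ s hs t ht (sub_left_inj.1 e1)).trans (by linarith)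

lemma ncard_le_of_cyclic (K₁ K₂ K₃ : EuclideanSpace ℝ (Fin d)) (β₁ β₂ β₃ : ℝ)
    (h₁ : ∀ s ∈ S, |⟪c s - a s, K₁ - a s⟫ - β₁| ≤ D * L ^ (-(2 * γ)) / 2)
    (h₂ : ∀ s ∈ S, |⟪a s - b s, K₂ - b s⟫ - β₂| ≤ D * L ^ (-(2 * γ)) / 2)
    (h₃ : ∀ s ∈ S, |⟪b s - c s, K₃ - c s⟫ - β₃| ≤ D * L ^ (-(2 * γ)) / 2) :
    (S.ncard : ℝ) ≤
      countConst d * D ^ 3 * L ^ (3 * ((d : ℝ) - γ) - 1.01 * min γ (1 - γ)) := by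
  have hε : 0 ≤ D * L ^ (-(2 * γ)) := by
    have := Real.rpow_pos_of_pos (by linarith : 0 < L) (-(2 * γ))
    positivity
  have hcc : ∀ {s t}, c s - a s = c t - a t → c s - c t = a s - a t := by
    intro s t e
    rw [sub_eq_sub_iff_add_eq_add] at e ⊢
    rw [e, add_comm]
  refine ncard_triples_le hd hγ hγ' hL hD S (fun s => c s - a s) (fun s => b s - c s) a
    (fun s hs t ht e1 e2 e3 => ?_)
    (fun s hs => ZLat.sub_mem (hc s hs) (ha s hs)) (fun s hs => ZLat.sub_mem (hb s hs) (hc s hs)) ha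
    (fun s hs t ht => ?_) (fun s hs t ht => ?_)
    (fun s hs t ht => (hba s hs t ht).trans (by norm_num))
    (fun s hs t ht e1 e2 => ?_) (fun s hs t ht e1 e2 => ?_)
    (Or.inr ⟨fun p => -((1 / 2 : ℝ) • (p + (K₃ - K₂))), fun p => β₁ + β₂ + β₃ +
      ‖(1 / 2 : ℝ) • (p + (K₃ - K₂))‖ ^ 2 - ‖p‖ ^ 2 - ⟪p, K₁ - K₂⟫, fun s hs => ?_⟩)
  · have hcst : c s = c t := by simpa only [e3, sub_left_inj] using e1
    have hbst : b s = b t := by simpa only [hcst, sub_left_inj] using e2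
    exact hinj s hs t ht e3 hbst hcst
  · rw [sub_sub_sub_comm]
    linarith [norm_sub_le (c s - c t) (a s - a t), hba s hs t ht, hbc s hs t ht]
  · rw [sub_sub_sub_comm]
    linarith [norm_sub_le (b s - b t) (c s - c t), hbb s hs t ht, hbc s hs t ht]
  · have i1 := h₁ s hs
    have i2 := h₁ t ht
    rw [← e1] at i2
    rw [inner_sub_right] at i1 i2 ⊢
    rw [abs_le] at *
    constructor <;> linarith
  · have i1 := h₃ s hs
    have i2 := h₃ t ht
    rw [← e2] at i2
    rw [← hcc e1]
    rw [inner_sub_right] at i1 i2 ⊢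
    rw [abs_le] at *
    constructor <;> linarith
  · have i1 := h₁ s hs
    have i2 := h₂ s hs
    have i3 := h₃ s hs
    simp only
    have key : ‖b s - c s - -((1 / 2 : ℝ) • (c s - a s + (K₃ - K₂)))‖ ^ 2 -
        (β₁ + β₂ + β₃ + ‖(1 / 2 : ℝ) • (c s - a s + (K₃ - K₂))‖ ^ 2 - ‖c s - a s‖ ^ 2 -
          ⟪c s - a s, K₁ - K₂⟫) =
        (⟪c s - a s, K₁ - a s⟫ - β₁) + (⟪a s - b s, K₂ - b s⟫ - β₂) +
          (⟪b s - c s, K₃ - c s⟫ - β₃) := by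
      rw [sub_neg_eq_add, norm_add_sq_real]
      simp only [← real_inner_self_eq_norm_sq, inner_sub_left, inner_sub_right,
        inner_add_right, inner_smul_right]
      rw [real_inner_comm (a s) (b s), real_inner_comm (a s) (c s), real_inner_comm (b s) (c s)]
      ring
    rw [key]
    rw [abs_le] at *
    constructor <;> linarith

end

lemma sign_cases {σ₁ σ₂ σ₃ σ₄ σ₅ σ₆ : ℝ}
    (h₁ : σ₁ = 1 ∨ σ₁ = -1) (h₂ : σ₂ = 1 ∨ σ₂ = -1) (h₃ : σ₃ = 1 ∨ σ₃ = -1)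
    (h₄ : σ₄ = 1 ∨ σ₄ = -1) (h₅ : σ₅ = 1 ∨ σ₅ = -1) (h₆ : σ₆ = 1 ∨ σ₆ = -1)
    (n₁ : ¬(σ₁ = σ₂ ∧ σ₂ = σ₄)) (n₂ : ¬(-σ₂ = σ₃ ∧ σ₃ = σ₅)) (n₃ : ¬(-σ₃ = -σ₄ ∧ -σ₄ = σ₆)) :
    (σ₁ = -σ₄ ∧ σ₆ = σ₄ ∧ (σ₅ = -σ₃ ∨ σ₅ = σ₂)) ∨
    (σ₁ = -σ₂ ∧ σ₅ = σ₂ ∧ (σ₆ = σ₄ ∨ σ₆ = σ₃)) ∨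
    (σ₅ = -σ₃ ∧ σ₆ = σ₃ ∧ (σ₁ = -σ₄ ∨ σ₁ = -σ₂)) ∨
    (σ₂ = σ₁ ∧ σ₃ = σ₁ ∧ σ₄ = -σ₁ ∧ σ₅ = σ₁ ∧ σ₆ = σ₁) ∨
    (σ₂ = -σ₁ ∧ σ₃ = -σ₁ ∧ σ₄ = σ₁ ∧ σ₅ = σ₁ ∧ σ₆ = σ₁) := by
  rcases h₁ with rfl | rfl <;> rcases h₂ with rfl | rfl <;> rcases h₃ with rfl | rfl <;>
    rcases h₄ with rfl | rfl <;> rcases h₅ with rfl | rfl <;> rcases h₆ with rfl | rfl <;>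
    norm_num at *

lemma ncard_sextuples_le {ι : Type*} {d : ℕ} (hd : 3 ≤ d) {γ L D : ℝ} (hγ : 0 < γ) (hγ' : γ < 1)
    (hL : 1 ≤ L) (hD : 1 ≤ D) {σ₁ σ₂ σ₃ σ₄ σ₅ σ₆ : ℝ}
    (h₁ : σ₁ = 1 ∨ σ₁ = -1) (h₂ : σ₂ = 1 ∨ σ₂ = -1) (h₃ : σ₃ = 1 ∨ σ₃ = -1)
    (h₄ : σ₄ = 1 ∨ σ₄ = -1) (h₅ : σ₅ = 1 ∨ σ₅ = -1) (h₆ : σ₆ = 1 ∨ σ₆ = -1)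
    (n₁ : ¬(σ₁ = σ₂ ∧ σ₂ = σ₄)) (n₂ : ¬(-σ₂ = σ₃ ∧ σ₃ = σ₅)) (n₃ : ¬(-σ₃ = -σ₄ ∧ -σ₄ = σ₆))
    {K₁ K₂ K₃ : EuclideanSpace ℝ (Fin d)} (hK₁ : K₁ ∈ ZLat d L) (hK₂ : K₂ ∈ ZLat d L)
    (hK₃ : K₃ ∈ ZLat d L) {β₁ β₂ β₃ : ℝ} (S : Set ι)
    (k₁ k₂ k₃ k₄ k₅ k₆ : ι → EuclideanSpace ℝ (Fin d))
    (hinj₀ : ∀ q ∈ S, ∀ p ∈ S, k₁ q = k₁ p → k₂ q = k₂ p → k₃ q = k₃ p → k₄ q = k₄ p →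
      k₅ q = k₅ p → k₆ q = k₆ p → q = p)
    (ha : ∀ q ∈ S, k₂ q ∈ ZLat d L) (hb : ∀ q ∈ S, k₃ q ∈ ZLat d L)
    (hc : ∀ q ∈ S, k₄ q ∈ ZLat d L)
    (hba : ∀ q ∈ S, ∀ p ∈ S, ‖k₂ q - k₂ p‖ ≤ 2) (hbb : ∀ q ∈ S, ∀ p ∈ S, ‖k₃ q - k₃ p‖ ≤ 2)
    (hbc : ∀ q ∈ S, ∀ p ∈ S, ‖k₄ q - k₄ p‖ ≤ 2)
    (hlin : ∀ q ∈ S, σ₁ • k₁ q + σ₂ • k₂ q + σ₄ • k₄ q = K₁ ∧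
      -(σ₂ • k₂ q) + σ₃ • k₃ q + σ₅ • k₅ q = K₂ ∧
      -(σ₃ • k₃ q) - σ₄ • k₄ q + σ₆ • k₆ q = K₃)
    (hquad : ∀ q ∈ S,
      |σ₁ * ‖k₁ q‖ ^ 2 + σ₂ * ‖k₂ q‖ ^ 2 + σ₄ * ‖k₄ q‖ ^ 2 - β₁| ≤ D * L ^ (-(2 * γ)) ∧
      |-(σ₂ * ‖k₂ q‖ ^ 2) + σ₃ * ‖k₃ q‖ ^ 2 + σ₅ * ‖k₅ q‖ ^ 2 - β₂| ≤ D * L ^ (-(2 * γ)) ∧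
      |-(σ₃ * ‖k₃ q‖ ^ 2) - σ₄ * ‖k₄ q‖ ^ 2 + σ₆ * ‖k₆ q‖ ^ 2 - β₃| ≤ D * L ^ (-(2 * γ))) :
    (S.ncard : ℝ) ≤
      countConst d * D ^ 3 * L ^ (3 * ((d : ℝ) - γ) - 1.01 * min γ (1 - γ)) := by
  have ne : ∀ {σ : ℝ}, σ = 1 ∨ σ = -1 → σ ≠ 0 := by
    rintro σ (rfl | rfl) <;> norm_num
  have opp : ∀ {σ : ℝ}, σ = 1 ∨ σ = -1 → -σ = 1 ∨ -σ = -1 := by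
    rintro σ (rfl | rfl) <;> norm_num
  have hinj : ∀ q ∈ S, ∀ p ∈ S, k₂ q = k₂ p → k₃ q = k₃ p → k₄ q = k₄ p →
      q = p := by
    intro q hq p hp e2 e3 e4
    obtain ⟨l₁, l₂, l₃⟩ := hlin q hq
    obtain ⟨m₁, m₂, m₃⟩ := hlin p hp
    rw [← m₁, e2, e4, add_left_inj, add_left_inj] at l₁
    rw [← m₂, e2, e3, add_right_inj] at l₂
    rw [← m₃, e3, e4, add_right_inj] at l₃
    exact hinj₀ q hq p hp (smul_right_injective _ (ne h₁) l₁) e2 e3 e4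
      (smul_right_injective _ (ne h₅) l₂) (smul_right_injective _ (ne h₆) l₃)
  set ε := D * L ^ (-(2 * γ)) with hε
  have ac : σ₁ = -σ₄ → SlabRel L ε S k₂ k₄ := fun h =>
    slabRel_of_vertex (k := k₁) (β := β₁) h₁ h₂ h hK₁ (fun q hq => (hlin q hq).1)
      (fun q hq => (hquad q hq).1)
  have ca : σ₁ = -σ₂ → SlabRel L ε S k₄ k₂ := fun h =>
    slabRel_of_vertex (k := k₁) (β := β₁) h₁ h₄ h hK₁
      (fun q hq => by rw [← (hlin q hq).1]; module)
      (fun q hq => le_of_eq_of_le (by ring_nf) (hquad q hq).1)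
  have ab : σ₅ = -σ₃ → SlabRel L ε S k₂ k₃ := fun h =>
    slabRel_of_vertex (k := k₅) (β := β₂) h₅ (opp h₂) h hK₂
      (fun q hq => by rw [← (hlin q hq).2.1]; module)
      (fun q hq => le_of_eq_of_le (by ring_nf) (hquad q hq).2.1)
  have ba : σ₅ = σ₂ → SlabRel L ε S k₃ k₂ := fun h =>
    slabRel_of_vertex (k := k₅) (t := -σ₂) (β := β₂) h₅ h₃
      (by rw [h, neg_neg]) hK₂
      (fun q hq => by rw [← (hlin q hq).2.1]; module)
      (fun q hq => le_of_eq_of_le (by ring_nf) (hquad q hq).2.1)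
  have bc : σ₆ = σ₄ → SlabRel L ε S k₃ k₄ := fun h =>
    slabRel_of_vertex (k := k₆) (t := -σ₄) (β := β₃) h₆ (opp h₃)
      (by rw [h, neg_neg]) hK₃
      (fun q hq => by rw [← (hlin q hq).2.2]; module)
      (fun q hq => le_of_eq_of_le (by ring_nf) (hquad q hq).2.2)
  have cb : σ₆ = σ₃ → SlabRel L ε S k₄ k₃ := fun h =>
    slabRel_of_vertex (k := k₆) (t := -σ₃) (β := β₃) h₆ (opp h₄)
      (by rw [h, neg_neg]) hK₃
      (fun q hq => by rw [← (hlin q hq).2.2]; module)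
      (fun q hq => le_of_eq_of_le (by ring_nf) (hquad q hq).2.2)
  rcases sign_cases h₁ h₂ h₃ h₄ h₅ h₆ n₁ n₂ n₃ with ⟨e, f, g | g⟩ | ⟨e, f, g | g⟩ |
    ⟨e, f, g | g⟩ | ⟨e2, e3, e4, e5, e6⟩ | ⟨e2, e3, e4, e5, e6⟩
  · exact ncard_le_of_sink hd hγ hγ' hL hD S k₂ k₃ k₄ hinj ha hb hc hba hbb hbc (ac e) (bc f) (ab g)
  · exact ncard_le_of_sink hd hγ hγ' hL hD S k₃ k₂ k₄ (fun q hq p hp i j k => hinj q hq p hp j i k)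
      hb ha hc hbb hba hbc (bc f) (ac e) (ba g)
  · exact ncard_le_of_sink hd hγ hγ' hL hD S k₃ k₄ k₂ (fun q hq p hp i j k => hinj q hq p hp k i j)
      hb hc ha hbb hbc hba (ba f) (ca e) (bc g)
  · exact ncard_le_of_sink hd hγ hγ' hL hD S k₄ k₃ k₂ (fun q hq p hp i j k => hinj q hq p hp k j i)
      hc hb ha hbc hbb hba (ca e) (ba f) (cb g)
  · exact ncard_le_of_sink hd hγ hγ' hL hD S k₂ k₄ k₃ (fun q hq p hp i j k => hinj q hq p hp i k j)
      ha hc hb hba hbc hbb (ab e) (cb f) (ac g)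
  · exact ncard_le_of_sink hd hγ hγ' hL hD S k₄ k₂ k₃ (fun q hq p hp i j k => hinj q hq p hp j k i)
      hc ha hb hbc hba hbb (cb f) (ab e) (ca g)
  · subst e2 e3 e4 e5 e6
    exact ncard_le_of_cyclic hd hγ hγ' hL hD S k₂ k₃ k₄ hinj ha hb hc hba hbb hbc _ _ _ _ _ _
      (fun q hq => cyclic_vertex h₁ (k := k₁ q) (K := K₁) (β := β₁)
        (by rw [← (hlin q hq).1]; module)
        (le_of_eq_of_le (by ring_nf) (hquad q hq).1))
      (fun q hq => cyclic_vertex h₁ (k := k₅ q) (K := K₂) (β := β₂)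
        (by rw [← (hlin q hq).2.1]; module)
        (le_of_eq_of_le (by ring_nf) (hquad q hq).2.1))
      (fun q hq => cyclic_vertex h₁ (k := k₆ q) (K := K₃) (β := β₃)
        (by rw [← (hlin q hq).2.2]; module)
        (le_of_eq_of_le (by ring_nf) (hquad q hq).2.2))
  · subst e2 e3 e4 e5 e6
    exact ncard_le_of_cyclic hd hγ hγ' hL hD S k₄ k₃ k₂
      (fun q hq p hp i j k => hinj q hq p hp k j i) hc hb ha hbc hbb hba _ _ _ _ _ _
      (fun q hq => cyclic_vertex h₁ (k := k₁ q) (K := K₁) (β := β₁)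
        (by rw [← (hlin q hq).1]; module)
        (le_of_eq_of_le (by ring_nf) (hquad q hq).1))
      (fun q hq => cyclic_vertex h₁ (k := k₆ q) (K := K₃) (β := β₃)
        (by rw [← (hlin q hq).2.2]; module)
        (le_of_eq_of_le (by ring_nf) (hquad q hq).2.2))
      (fun q hq => cyclic_vertex h₁ (k := k₅ q) (K := K₂) (β := β₂)
        (by rw [← (hlin q hq).2.1]; module)
        (le_of_eq_of_le (by ring_nf) (hquad q hq).2.1))

theorem statement11 (d : ℕ) (hd : 3 ≤ d) (γ : ℝ) (hγ : 0 < γ) (hγ' : γ < 1) :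
    ∃ η₀ : ℝ, 0 < η₀ ∧ ∀ η : ℝ, 0 < η → η ≤ η₀ →
    ∃ C : ℝ, 2 ≤ C ∧
    ∀ L δ : ℝ, C ≤ L → 0 < δ → δ < 1 → δ⁻¹ ≤ L ^ (η ^ 2) →
    ∀ σ₁ σ₂ σ₃ σ₄ σ₅ σ₆ : ℝ,
      (σ₁ = 1 ∨ σ₁ = -1) → (σ₂ = 1 ∨ σ₂ = -1) → (σ₃ = 1 ∨ σ₃ = -1) →
      (σ₄ = 1 ∨ σ₄ = -1) → (σ₅ = 1 ∨ σ₅ = -1) → (σ₆ = 1 ∨ σ₆ = -1) →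
      ¬(σ₁ = σ₂ ∧ σ₂ = σ₄) → ¬(-σ₂ = σ₃ ∧ σ₃ = σ₅) → ¬(-σ₃ = -σ₄ ∧ -σ₄ = σ₆) →
    ∀ (k10 k20 k30 k40 k50 k60 k1' k2' k3' : EuclideanSpace ℝ (Fin d)),
      k1' ∈ ZLat d L → k2' ∈ ZLat d L → k3' ∈ ZLat d L →
    ∀ β1 β2 β3 : ℝ,
      (Set.ncard {q : EuclideanSpace ℝ (Fin d) × EuclideanSpace ℝ (Fin d) ×
          EuclideanSpace ℝ (Fin d) × EuclideanSpace ℝ (Fin d) × EuclideanSpace ℝ (Fin d) ×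
          EuclideanSpace ℝ (Fin d) |
        q.1 ∈ ZLat d L ∧ q.2.1 ∈ ZLat d L ∧ q.2.2.1 ∈ ZLat d L ∧ q.2.2.2.1 ∈ ZLat d L ∧
        q.2.2.2.2.1 ∈ ZLat d L ∧ q.2.2.2.2.2 ∈ ZLat d L ∧
        ‖q.1 - k10‖ ≤ 1 ∧ ‖q.2.1 - k20‖ ≤ 1 ∧ ‖q.2.2.1 - k30‖ ≤ 1 ∧ ‖q.2.2.2.1 - k40‖ ≤ 1 ∧
        ‖q.2.2.2.2.1 - k50‖ ≤ 1 ∧ ‖q.2.2.2.2.2 - k60‖ ≤ 1 ∧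
        σ₁ • q.1 + σ₂ • q.2.1 + σ₄ • q.2.2.2.1 = k1' ∧
        -(σ₂ • q.2.1) + σ₃ • q.2.2.1 + σ₅ • q.2.2.2.2.1 = k2' ∧
        -(σ₃ • q.2.2.1) - σ₄ • q.2.2.2.1 + σ₆ • q.2.2.2.2.2 = k3' ∧
        |σ₁ * ‖q.1‖ ^ 2 + σ₂ * ‖q.2.1‖ ^ 2 + σ₄ * ‖q.2.2.2.1‖ ^ 2 - β1| ≤
          δ⁻¹ * L ^ (-(2 * γ)) ∧
        |-(σ₂ * ‖q.2.1‖ ^ 2) + σ₃ * ‖q.2.2.1‖ ^ 2 + σ₅ * ‖q.2.2.2.2.1‖ ^ 2 - β2| ≤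
          δ⁻¹ * L ^ (-(2 * γ)) ∧
        |-(σ₃ * ‖q.2.2.1‖ ^ 2) - σ₄ * ‖q.2.2.2.1‖ ^ 2 + σ₆ * ‖q.2.2.2.2.2‖ ^ 2 - β3| ≤
          δ⁻¹ * L ^ (-(2 * γ))} : ℝ) ≤
      C * δ⁻¹ ^ 3 * L ^ (3 * ((d : ℝ) - γ) - 1.01 * min γ (1 - γ)) := by
  refine ⟨1, one_pos, fun η _ _ => ⟨max 2 (countConst d), le_max_left _ _, ?_⟩⟩
  intro L δ hCL hδ hδ' _ σ₁ σ₂ σ₃ σ₄ σ₅ σ₆ h₁ h₂ h₃ h₄ h₅ h₆ n₁ n₂ n₃ k10 k20 k30 k40 k50 k60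
    k1' k2' k3' hk1 hk2 hk3 β1 β2 β3
  have hL : 1 ≤ L := le_trans (by norm_num) ((le_max_left _ _).trans hCL)
  have hL0 : 0 < L := by linarith
  have hD : 1 ≤ δ⁻¹ := (one_le_inv₀ hδ).2 hδ'.le
  refine le_trans ?_ (show countConst d * δ⁻¹ ^ 3 *
    L ^ (3 * ((d : ℝ) - γ) - 1.01 * min γ (1 - γ)) ≤ _ by
      have := Real.rpow_pos_of_pos hL0 (3 * ((d : ℝ) - γ) - 1.01 * min γ (1 - γ))
      gcongr
      exact le_max_right _ _)
  have diam : ∀ {x y k : EuclideanSpace ℝ (Fin d)}, ‖x - k‖ ≤ 1 → ‖y - k‖ ≤ 1 → ‖x - y‖ ≤ 2 := by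
    intro x y k hx hy
    rw [← sub_sub_sub_cancel_right x y k]
    linarith [norm_sub_le (x - k) (y - k)]
  refine ncard_sextuples_le hd hγ hγ' hL hD h₁ h₂ h₃ h₄ h₅ h₆ n₁ n₂ n₃ hk1 hk2 hk3 (β₁ := β1)
    (β₂ := β2) (β₃ := β3) _
    (fun q => q.1) (fun q => q.2.1) (fun q => q.2.2.1) (fun q => q.2.2.2.1)
    (fun q => q.2.2.2.2.1) (fun q => q.2.2.2.2.2)
    (fun q _ p _ e₁ e₂ e₃ e₄ e₅ e₆ => Prod.ext e₁ (Prod.ext e₂ (Prod.ext e₃ (Prod.ext e₄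
      (Prod.ext e₅ e₆)))))
    ?_ ?_ ?_ ?_ ?_ ?_ ?_ ?_
  · rintro q ⟨-, h, -⟩
    exact h
  · rintro q ⟨-, -, h, -⟩
    exact h
  · rintro q ⟨-, -, -, h, -⟩
    exact h
  · rintro q ⟨-, -, -, -, -, -, -, hq, -⟩ p ⟨-, -, -, -, -, -, -, hp, -⟩
    exact diam hq hp
  · rintro q ⟨-, -, -, -, -, -, -, -, hq, -⟩ p ⟨-, -, -, -, -, -, -, -, hp, -⟩
    exact diam hq hp
  · rintro q ⟨-, -, -, -, -, -, -, -, -, hq, -⟩ p ⟨-, -, -, -, -, -, -, -, -, hp, -⟩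
    exact diam hq hp
  · rintro q ⟨-, -, -, -, -, -, -, -, -, -, -, -, l₁, l₂, l₃, -⟩
    exact ⟨l₁, l₂, l₃⟩
  · rintro q ⟨-, -, -, -, -, -, -, -, -, -, -, -, -, -, -, q₁, q₂, q₃⟩
    exact ⟨q₁, q₂, q₃⟩
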